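/- arXiv:2310.03516 — 2 statements merged into one kernel-verified Lean document; each statement's English description precedes it below -/
import Mathlib

section
/- Let P = ∩_{i=1}^m B̄_{e_i}(x_i) be a h-convex polytope in ℍ^{n+1} with u(P,e_i) = x_i, and suppose F(P,e_i) is a facet of P. For t > 0 let P_t = {X ∈ ℍ^{n+1} : 0 < d(P,X) ≤ t and the nearest point of P to X lies in the relative interior of F(P,e_i)}. Then V(P_t) = ((e^{nt} − 1)/n) · S(P,e_i) for every t > 0. -/
noncomputable section

open Real MeasureTheory Filter Topology Set
open scoped ENNReal symmDiff

namespace Horo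

/-- The Lorentzian inner product on ℝ^{n+2}:
`X·Y = Σ_{i=1}^{n+1} x_i y_i − x_{n+2} y_{n+2}`. -/
def lprod (n : ℕ) (X Y : Fin (n + 2) → ℝ) : ℝ :=
  (∑ i : Fin (n + 1), X i.castSucc * Y i.castSucc) - X (Fin.last (n + 1)) * Y (Fin.last (n + 1))

/-- The hyperboloid model ℍ^{n+1} of hyperbolic space. -/
def Hyp (n : ℕ) : Set (Fin (n + 2) → ℝ) :=
  {X | lprod n X X = -1 ∧ 0 < X (Fin.last (n + 1))}

/-- The origin O = (0,…,0,1) of hyperbolic space. -/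
def origin (n : ℕ) : Fin (n + 2) → ℝ := Fin.snoc (fun _ => 0) 1

/-- The unit sphere 𝕊^n ⊂ ℝ^{n+1}. -/
def sph (n : ℕ) : Set (Fin (n + 1) → ℝ) := {e | ∑ i, e i ^ 2 = 1}

/-- The null vector (e,1) ∈ ℝ^{n+2} associated with e ∈ 𝕊^n. -/
def dir {n : ℕ} (e : Fin (n + 1) → ℝ) : Fin (n + 2) → ℝ := Fin.snoc e 1

/-- The geodesic distance d(X,Y) = arcosh(−X·Y) on the hyperboloid. -/
def dH (n : ℕ) (X Y : Fin (n + 2) → ℝ) : ℝ :=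
  Real.log (-(lprod n X Y) + Real.sqrt ((lprod n X Y) ^ 2 - 1))

/-- The horosphere H_e(s) = {X ∈ ℍ^{n+1} : X·(e,1) = −e^s}. -/
def horoSphere (n : ℕ) (e : Fin (n + 1) → ℝ) (s : ℝ) : Set (Fin (n + 2) → ℝ) :=
  {X ∈ Hyp n | lprod n X (dir e) = -Real.exp s}

/-- The open horo-ball B_e(s) = {X ∈ ℍ^{n+1} : 0 > X·(e,1) > −e^s}. -/
def horoBall (n : ℕ) (e : Fin (n + 1) → ℝ) (s : ℝ) : Set (Fin (n + 2) → ℝ) :=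
  {X ∈ Hyp n | 0 > lprod n X (dir e) ∧ lprod n X (dir e) > -Real.exp s}

/-- The closed horo-ball B̄_e(s) = {X ∈ ℍ^{n+1} : 0 > X·(e,1) ≥ −e^s}. -/
def horoBallCl (n : ℕ) (e : Fin (n + 1) → ℝ) (s : ℝ) : Set (Fin (n + 2) → ℝ) :=
  {X ∈ Hyp n | 0 > lprod n X (dir e) ∧ lprod n X (dir e) ≥ -Real.exp s}

/-- A set Ω ⊂ ℍ^{n+1} is horospherically convex (h-convex) if it is closed and every
relative boundary point of Ω admits a supporting horo-ball. -/
def IsHConvex (n : ℕ) (Ω : Set (Fin (n + 2) → ℝ)) : Prop :=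
  Ω ⊆ Hyp n ∧ IsClosed Ω ∧
    ∀ X ∈ Ω ∩ closure (Hyp n \ Ω),
      ∃ e ∈ sph n, ∃ s : ℝ, Ω ⊆ horoBallCl n e s ∧ X ∈ horoSphere n e s

/-- The interior of a subset of the hyperboloid, relative to the hyperboloid. -/
def relInt (n : ℕ) (K : Set (Fin (n + 2) → ℝ)) : Set (Fin (n + 2) → ℝ) :=
  {X ∈ Hyp n | ∃ ε > 0, ∀ Y ∈ Hyp n, dH n X Y < ε → Y ∈ K}

/-- A h-convex body: a compact h-convex set with nonempty (relative) interior. -/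
def IsHConvexBody (n : ℕ) (K : Set (Fin (n + 2) → ℝ)) : Prop :=
  IsHConvex n K ∧ IsCompact K ∧ (relInt n K).Nonempty

/-- A h-convex polytope: a h-convex body which is a finite intersection of closed
horo-balls. -/
def IsHPolytope (n : ℕ) (P : Set (Fin (n + 2) → ℝ)) : Prop :=
  IsHConvexBody n P ∧ ∃ m : ℕ, 2 ≤ m ∧ ∃ (e : Fin m → (Fin (n + 1) → ℝ)) (u : Fin m → ℝ),
    (∀ i, e i ∈ sph n) ∧ P = ⋂ i, horoBallCl n (e i) (u i)

/-- The horospherical support function u(K,e) = sup{log(−X·(e,1)) : X ∈ K}. -/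
def suppFn (n : ℕ) (K : Set (Fin (n + 2) → ℝ)) (e : Fin (n + 1) → ℝ) : ℝ :=
  sSup ((fun X => Real.log (-(lprod n X (dir e)))) '' K)

/-- The outer parallel set K^ε = {X ∈ ℍ^{n+1} : d(K,X) ≤ ε}. -/
def outPar (n : ℕ) (K : Set (Fin (n + 2) → ℝ)) (ε : ℝ) : Set (Fin (n + 2) → ℝ) :=
  {X ∈ Hyp n | ∃ Y ∈ K, dH n Y X ≤ ε}

/-- The Hausdorff distance d_H(K,L) = inf{ε ≥ 0 : K ⊆ L^ε and L ⊆ K^ε}. -/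
def dHaus (n : ℕ) (K L : Set (Fin (n + 2) → ℝ)) : ℝ :=
  sInf {ε : ℝ | 0 ≤ ε ∧ K ⊆ outPar n L ε ∧ L ⊆ outPar n K ε}

/-- The point (sinh r · θ, cosh r) ∈ ℍ^{n+1} at distance r from O in direction θ. -/
def rpt (n : ℕ) (θ : Fin (n + 1) → ℝ) (r : ℝ) : Fin (n + 2) → ℝ :=
  Fin.snoc (fun i => Real.sinh r * θ i) (Real.cosh r)

/-- The radial function ρ(K,θ) = max{λ ≥ 0 : (sinh λ · θ, cosh λ) ∈ K}. -/
def radFn (n : ℕ) (K : Set (Fin (n + 2) → ℝ)) (θ : Fin (n + 1) → ℝ) : ℝ :=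
  sSup {r : ℝ | 0 ≤ r ∧ rpt n θ r ∈ K}

/-- R(K) = max_θ ρ(K,θ). -/
def Rmax (n : ℕ) (K : Set (Fin (n + 2) → ℝ)) : ℝ := sSup (radFn n K '' sph n)

/-- r(K) = min_θ ρ(K,θ). -/
def rmin (n : ℕ) (K : Set (Fin (n + 2) → ℝ)) : ℝ := sInf (radFn n K '' sph n)

/-- The point reflection (x_1,…,x_{n+1},x_{n+2}) ↦ (−x_1,…,−x_{n+1},x_{n+2}) about O. -/
def symMap (n : ℕ) (X : Fin (n + 2) → ℝ) : Fin (n + 2) → ℝ :=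
  fun i => if i = Fin.last (n + 1) then X i else -X i

/-- The hyperbolic (Riemannian) volume of a subset of the hyperboloid, computed via the
graph parametrization x ↦ (x, √(1+|x|²)), whose volume density is 1/√(1+|x|²). -/
def hypVol (n : ℕ) (K : Set (Fin (n + 2) → ℝ)) : ℝ :=
  ∫ x : Fin (n + 1) → ℝ,
    Set.indicator {y : Fin (n + 1) → ℝ | Fin.snoc y (Real.sqrt (1 + ∑ i, y i ^ 2)) ∈ K}
      (fun y => 1 / Real.sqrt (1 + ∑ i, y i ^ 2)) x

/-- The distance from a point X to a set P. -/
def distTo (n : ℕ) (P : Set (Fin (n + 2) → ℝ)) (X : Fin (n + 2) → ℝ) : ℝ :=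
  sInf ((fun Y => dH n Y X) '' P)

/-- The facet F(P,e) = P ∩ H_e(u(P,e)). -/
def facet (n : ℕ) (P : Set (Fin (n + 2) → ℝ)) (e : Fin (n + 1) → ℝ) :
    Set (Fin (n + 2) → ℝ) :=
  P ∩ horoSphere n e (suppFn n P e)

/-- The relative interior of the facet F(P,e) inside the horosphere H_e(u(P,e)). -/
def facetRelInt (n : ℕ) (P : Set (Fin (n + 2) → ℝ)) (e : Fin (n + 1) → ℝ) :
    Set (Fin (n + 2) → ℝ) :=
  {Y ∈ facet n P e | ∃ δ > 0, ∀ Z ∈ horoSphere n e (suppFn n P e),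
    dH n Y Z < δ → Z ∈ facet n P e}

/-- The collar 𝒫_t(P, F̊(P,e)): points at positive distance ≤ t from P whose nearest
point in P lies in the relative interior of the facet F(P,e). -/
def collar (n : ℕ) (P : Set (Fin (n + 2) → ℝ)) (e : Fin (n + 1) → ℝ) (t : ℝ) :
    Set (Fin (n + 2) → ℝ) :=
  {X ∈ Hyp n | 0 < distTo n P X ∧ distTo n P X ≤ t ∧
    ∃ Y ∈ facetRelInt n P e, ∀ Z ∈ P, dH n Y X ≤ dH n Z X}

/-- The diameter of a set with respect to a distance function, in ℝ≥0∞. -/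
def ediamWith {α : Type*} (d : α → α → ℝ) (U : Set α) : ℝ≥0∞ :=
  ⨆ (x ∈ U) (y ∈ U), ENNReal.ofReal (d x y)

/-- The (unnormalized) s-dimensional Hausdorff measure associated with a distance
function d, via the Carathéodory construction. -/
def hMeasWith {α : Type*} (d : α → α → ℝ) (s : ℕ) (A : Set α) : ℝ≥0∞ :=
  ⨆ (δ : ℝ) (_ : 0 < δ),
    ⨅ (U : ℕ → Set α) (_ : A ⊆ ⋃ i, U i) (_ : ∀ i, ediamWith d (U i) ≤ ENNReal.ofReal δ),
      ∑' i, ediamWith d (U i) ^ s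

/-- ω_n, the volume of the unit ball in ℝ^n. -/
def unitBallVol (n : ℕ) : ℝ :=
  (volume (Metric.ball (0 : EuclideanSpace ℝ (Fin n)) 1)).toReal

/-- S(P,e): the n-dimensional area of the facet F(P,e), i.e. the normalized
n-dimensional Hausdorff measure of F(P,e) with respect to the hyperbolic distance. -/
def areaFacet (n : ℕ) (P : Set (Fin (n + 2) → ℝ)) (e : Fin (n + 1) → ℝ) : ℝ :=
  (ENNReal.ofReal (unitBallVol n / 2 ^ n) * hMeasWith (dH n) n (facet n P e)).toReal


/-- Steiner symmetrization of `A ⊂ ℝⁿ` with respect to the `i`-th coordinate hyperplane. -/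
def steiner {n : ℕ} (i : Fin n) (A : Set (Fin n → ℝ)) : Set (Fin n → ℝ) :=
  {x | ENNReal.ofReal (2 * |x i|) < volume {t : ℝ | Function.update x i t ∈ A}}

lemma measurable_volume_slice {n : ℕ} (i : Fin n) {A : Set (Fin n → ℝ)} (hA : MeasurableSet A) :
    Measurable fun x : Fin n → ℝ => volume {t : ℝ | Function.update x i t ∈ A} := by
  have h := Measurable.lmarginal (s := {i}) (fun _ : Fin n => (volume : Measure ℝ))
    (measurable_const.indicator hA : Measurable (A.indicator fun _ => (1 : ℝ≥0∞)))
  rw [lmarginal_singleton] at h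
  convert h using 2 with x
  have hm : MeasurableSet {t : ℝ | Function.update x i t ∈ A} :=
    (measurable_update x) hA
  rw [← lintegral_indicator_one hm]
  rfl

lemma measurableSet_steiner {n : ℕ} (i : Fin n) {A : Set (Fin n → ℝ)} (hA : MeasurableSet A) :
    MeasurableSet (steiner i A) := by
  refine measurableSet_lt ?_ (measurable_volume_slice i hA)
  fun_prop

lemma volume_setOf_ofReal_two_mul_abs_lt (l : ℝ≥0∞) :
    volume {t : ℝ | ENNReal.ofReal (2 * |t|) < l} = l := by
  induction l with
  | top => simp only [ENNReal.ofReal_lt_top, Set.ofPred_true, Real.volume_univ]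
  | coe r =>
    have : {t : ℝ | ENNReal.ofReal (2 * |t|) < r} = Ioo (-(r / 2) : ℝ) (r / 2) := by
      ext t
      rw [mem_ofPred_eq, mem_Ioo, ← abs_lt, ← ENNReal.ofReal_coe_nnreal,
        ENNReal.ofReal_lt_ofReal_iff_of_nonneg (by positivity), lt_div_iff₀' two_pos]
    rw [this, Real.volume_Ioo, ← ENNReal.ofReal_coe_nnreal]
    ring_nf

lemma volume_steiner {n : ℕ} (i : Fin n) {A : Set (Fin n → ℝ)} (hA : MeasurableSet A) :
    volume (steiner i A) = volume A := by
  have hS := measurableSet_steiner i hA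
  rw [← lintegral_indicator_one hA, ← lintegral_indicator_one hS]
  refine lintegral_eq_of_lmarginal_eq (μ := fun _ : Fin n => (volume : Measure ℝ)) {i}
    (measurable_one.indicator hS) (measurable_one.indicator hA) ?_
  simp only [lmarginal_singleton]
  funext x
  have h1 : ∀ B : Set (Fin n → ℝ), MeasurableSet B →
      ∫⁻ t : ℝ, B.indicator 1 (Function.update x i t) =
        volume {t : ℝ | Function.update x i t ∈ B} := by
    intro B hB
    have hm : MeasurableSet {t : ℝ | Function.update x i t ∈ B} := (measurable_update x) hB
    rw [← lintegral_indicator_one hm]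
    rfl
  rw [h1 _ hS, h1 _ hA]
  simp only [steiner, mem_ofPred_eq, Function.update_self, Function.update_idem]
  exact volume_setOf_ofReal_two_mul_abs_lt _

lemma exists_of_mem_steiner {n : ℕ} {i : Fin n} {A : Set (Fin n → ℝ)} {x : Fin n → ℝ}
    (hx : x ∈ steiner i A) :
    ∃ p q : ℝ, Function.update x i p ∈ A ∧ Function.update x i q ∈ A ∧ 2 * |x i| < q - p := by
  have h := lt_of_lt_of_le hx (Real.volume_le_diam _)
  simp only [Metric.ediam, lt_iSup_iff] at h
  obtain ⟨p, hp, q, hq, h⟩ := h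
  rw [edist_dist, ENNReal.ofReal_lt_ofReal_iff_of_nonneg (by positivity), Real.dist_eq] at h
  rcases le_total p q with hpq | hpq
  · exact ⟨p, q, hp, hq, by rwa [abs_sub_comm, abs_of_nonneg (sub_nonneg.2 hpq)] at h⟩
  · exact ⟨q, p, hq, hp, by rwa [abs_of_nonneg (sub_nonneg.2 hpq)] at h⟩

lemma sum_sq_sub_steiner_le {n : ℕ} (i : Fin n) {A : Set (Fin n → ℝ)} {D : ℝ}
    (hA : ∀ x ∈ A, ∀ y ∈ A, ∑ j, (x j - y j) ^ 2 ≤ D) :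
    ∀ x ∈ steiner i A, ∀ y ∈ steiner i A, ∑ j, (x j - y j) ^ 2 ≤ D := by
  intro x hx y hy
  obtain ⟨p, q, hp, hq, hpq⟩ := exists_of_mem_steiner hx
  obtain ⟨p', q', hp', hq', hpq'⟩ := exists_of_mem_steiner hy
  have key : ∀ s t : ℝ, |x i - y i| ≤ |s - t| → Function.update x i s ∈ A →
      Function.update y i t ∈ A → ∑ j, (x j - y j) ^ 2 ≤ D := by
    intro s t hst hs ht
    refine le_trans (Finset.sum_le_sum fun j _ => ?_) (hA _ hs _ ht)
    by_cases hj : j = i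
    · subst hj
      simpa using sq_le_sq.2 hst
    · simp [hj]
  have hxy : |x i - y i| ≤ |x i| + |y i| := abs_sub _ _
  rcases le_total (q' - p) (q - p') with h | h
  · exact key q p' (by rw [le_abs]; left; linarith) hq hp'
  · exact key p q' (by rw [le_abs]; right; linarith) hp hq'

/-- Reflection in the `i`-th coordinate hyperplane of `ℝⁿ`. -/
def coordReflect {n : ℕ} (i : Fin n) (x : Fin n → ℝ) : Fin n → ℝ := Function.update x i (-x i)

lemma coordReflect_mem_steiner_self {n : ℕ} {i : Fin n} {A : Set (Fin n → ℝ)} {x : Fin n → ℝ}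
    (hx : x ∈ steiner i A) : coordReflect i x ∈ steiner i A := by
  simpa [steiner, coordReflect] using hx

lemma coordReflect_mem_steiner {n : ℕ} {i j : Fin n} (hij : i ≠ j) {A : Set (Fin n → ℝ)}
    (hA : ∀ x ∈ A, coordReflect i x ∈ A) {x : Fin n → ℝ} (hx : x ∈ steiner j A) :
    coordReflect i x ∈ steiner j A := by
  simp only [steiner, coordReflect, mem_ofPred_eq, Function.update_of_ne hij.symm] at hx ⊢
  refine lt_of_lt_of_le hx (measure_mono fun t ht => ?_)
  have := hA _ ht
  rwa [coordReflect, Function.update_of_ne hij, Function.update_comm hij.symm] at this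

lemma exists_symmetrization {n : ℕ} {A : Set (Fin n → ℝ)} (hm : MeasurableSet A) {D : ℝ}
    (hA : ∀ x ∈ A, ∀ y ∈ A, ∑ j, (x j - y j) ^ 2 ≤ D) (s : Finset (Fin n)) :
    ∃ B : Set (Fin n → ℝ), MeasurableSet B ∧ volume B = volume A ∧
      (∀ x ∈ B, ∀ y ∈ B, ∑ j, (x j - y j) ^ 2 ≤ D) ∧
      ∀ i ∈ s, ∀ x ∈ B, coordReflect i x ∈ B := by
  induction s using Finset.induction_on with
  | empty => exact ⟨A, hm, rfl, hA, by simp⟩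
  | insert j s hj ih =>
    obtain ⟨B, hB, hv, hD, hs⟩ := ih
    refine ⟨steiner j B, measurableSet_steiner j hB, (volume_steiner j hB).trans hv,
      sum_sq_sub_steiner_le j hD, fun i hi x hx => ?_⟩
    by_cases hij : i = j
    · subst hij
      exact coordReflect_mem_steiner_self hx
    · exact coordReflect_mem_steiner hij (hs i (Finset.mem_of_mem_insert_of_ne hi hij)) hx

lemma neg_mem_of_coordReflect_mem {n : ℕ} {B : Set (Fin n → ℝ)}
    (hB : ∀ i, ∀ x ∈ B, coordReflect i x ∈ B) {x : Fin n → ℝ} (hx : x ∈ B) : -x ∈ B := by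
  have h : ∀ s : Finset (Fin n), (fun j => if j ∈ s then -x j else x j) ∈ B := by
    intro s
    induction s using Finset.induction_on with
    | empty => simpa using hx
    | insert i s hi ih =>
      convert hB i _ ih using 1
      funext j
      by_cases hj : j = i
      · subst hj
        simp [coordReflect, hi]
      · simp [coordReflect, hj]
  simpa [Pi.neg_def] using h Finset.univ

/-- The **isodiametric inequality** for measurable sets in coordinates. -/
lemma volume_le_of_sum_sq_sub_le {n : ℕ} {A : Set (Fin n → ℝ)} (hm : MeasurableSet A) {d : ℝ}
    (hA : ∀ x ∈ A, ∀ y ∈ A, ∑ j, (x j - y j) ^ 2 ≤ d ^ 2) :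
    volume A ≤ volume {x : Fin n → ℝ | ∑ j, x j ^ 2 ≤ (d / 2) ^ 2} := by
  obtain ⟨B, -, hv, hD, hs⟩ := exists_symmetrization hm hA Finset.univ
  rw [← hv]
  refine measure_mono fun x hx => ?_
  have h := hD x hx _ (neg_mem_of_coordReflect_mem (fun i => hs i (Finset.mem_univ i)) hx)
  have h4 : ∑ j, (x j - (-x) j) ^ 2 = 4 * ∑ j, x j ^ 2 := by
    rw [Finset.mul_sum]
    refine Finset.sum_congr rfl fun j _ => ?_
    simp only [Pi.neg_apply]
    ring
  rw [h4] at h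
  rw [mem_ofPred_eq]
  linarith

/-- The **isodiametric inequality** in Euclidean space. -/
lemma volume_le_ediam_pow {n : ℕ} (hn : n ≠ 0) (A : Set (EuclideanSpace ℝ (Fin n))) :
    volume A ≤ ENNReal.ofReal (unitBallVol n / 2 ^ n) * Metric.ediam A ^ n := by
  have hpos : 0 < unitBallVol n :=
    ENNReal.toReal_pos (Metric.measure_ball_pos _ _ one_pos).ne' measure_ball_lt_top.ne
  rcases eq_or_ne (Metric.ediam A) ⊤ with htop | htop
  · rw [htop, ENNReal.top_pow hn, ENNReal.mul_top]
    · exact le_top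
    · rw [Ne, ENNReal.ofReal_eq_zero, not_le]
      positivity
  set d : ℝ := (Metric.ediam A).toReal with hd
  have hd0 : 0 ≤ d := ENNReal.toReal_nonneg
  have hcl : ∀ x ∈ closure A, ∀ y ∈ closure A, dist x y ≤ d := by
    intro x hx y hy
    have h := Metric.edist_le_ediam_of_mem hx hy
    rw [Metric.ediam_closure, edist_dist] at h
    rw [hd]
    exact (ENNReal.ofReal_le_iff_le_toReal htop).1 h
  have hp := PiLp.volume_preserving_toLp (Fin n)
  have h1 : volume (closure A) =
      volume ((WithLp.toLp 2 : (Fin n → ℝ) → EuclideanSpace ℝ (Fin n)) ⁻¹' closure A) :=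
    (hp.measure_preimage isClosed_closure.measurableSet.nullMeasurableSet).symm
  have h2 : volume (Metric.closedBall (0 : EuclideanSpace ℝ (Fin n)) (d / 2)) =
      volume {x : Fin n → ℝ | ∑ j, x j ^ 2 ≤ (d / 2) ^ 2} := by
    rw [← hp.measure_preimage Metric.isClosed_closedBall.measurableSet.nullMeasurableSet]
    congr 1
    ext x
    rw [mem_preimage, mem_closedBall_zero_iff, mem_ofPred_eq,
      ← sq_le_sq₀ (norm_nonneg _) (by positivity), EuclideanSpace.norm_sq_eq]
    simp
  have h3 := volume_le_of_sum_sq_sub_le (d := d)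
    (hp.measurable isClosed_closure.measurableSet : MeasurableSet
      ((WithLp.toLp 2 : (Fin n → ℝ) → EuclideanSpace ℝ (Fin n)) ⁻¹' closure A)) (by
      intro x hx y hy
      have h := hcl _ hx _ hy
      rw [← sq_le_sq₀ dist_nonneg hd0, EuclideanSpace.dist_sq_eq] at h
      simpa [Real.dist_eq] using h)
  refine (measure_mono subset_closure).trans ?_
  rw [h1]
  refine h3.trans ?_
  rw [← h2, Measure.addHaar_closedBall _ _ (by positivity), finrank_euclideanSpace_fin,
    ← ENNReal.ofReal_toReal htop, ← hd, ← ENNReal.ofReal_pow hd0,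
    ← ENNReal.ofReal_mul (by positivity),
    ← ENNReal.ofReal_toReal (measure_ball_lt_top (x := (0 : EuclideanSpace ℝ (Fin n)))).ne,
    ← ENNReal.ofReal_mul (by positivity)]
  apply ENNReal.ofReal_le_ofReal
  rw [div_pow, unitBallVol]
  apply le_of_eq
  ring

lemma volume_le_hMeasWith {α : Type*} {n : ℕ} (hn : n ≠ 0) (d : α → α → ℝ)
    (φ : EuclideanSpace ℝ (Fin n) → α) {ε δ : ℝ} (hε : 0 < ε) (hδ : 0 < δ)
    (hφ : ∀ p q, d (φ p) (φ q) ≤ δ → dist p q ≤ (1 + ε) * d (φ p) (φ q))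
    (A : Set (EuclideanSpace ℝ (Fin n))) :
    volume A ≤ ENNReal.ofReal (1 + ε) ^ n *
      (ENNReal.ofReal (unitBallVol n / 2 ^ n) * hMeasWith d n (φ '' A)) := by
  have hpos : 0 < unitBallVol n :=
    ENNReal.toReal_pos (Metric.measure_ball_pos _ _ one_pos).ne' measure_ball_lt_top.ne
  have hc0 : ENNReal.ofReal (1 + ε) ^ n * ENNReal.ofReal (unitBallVol n / 2 ^ n) ≠ 0 := by
    simp only [ne_eq, mul_eq_zero, pow_eq_zero_iff hn, ENNReal.ofReal_eq_zero, not_or, not_le]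
    constructor <;> positivity
  have hct : ENNReal.ofReal (1 + ε) ^ n * ENNReal.ofReal (unitBallVol n / 2 ^ n) ≠ ⊤ := by finiteness
  rw [← mul_assoc, ← ENNReal.div_le_iff' hc0 hct]
  refine le_trans ?_ (le_iSup₂ (f := fun (δ : ℝ) (_ : 0 < δ) => _) δ hδ)
  refine le_iInf fun U => le_iInf fun hcov => le_iInf fun hU => ?_
  rw [ENNReal.div_le_iff' hc0 hct, ← ENNReal.tsum_mul_left]
  have hsub : A ⊆ ⋃ i, φ ⁻¹' U i := by
    intro p hp
    simpa using hcov (mem_image_of_mem φ hp)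
  refine (measure_mono hsub).trans ((measure_iUnion_le _).trans (ENNReal.tsum_le_tsum fun i => ?_))
  refine (volume_le_ediam_pow hn _).trans ?_
  have hdiam : Metric.ediam (φ ⁻¹' U i) ≤ ENNReal.ofReal (1 + ε) * ediamWith d (U i) := by
    refine Metric.ediam_le fun p hp q hq => ?_
    have h1 : ENNReal.ofReal (d (φ p) (φ q)) ≤ ediamWith d (U i) :=
      le_iSup₂_of_le (φ p) hp (le_iSup₂_of_le (φ q) hq le_rfl)
    have h2 : d (φ p) (φ q) ≤ δ := (ENNReal.ofReal_le_ofReal_iff hδ.le).1 (h1.trans (hU i))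
    rw [edist_dist]
    refine (ENNReal.ofReal_le_ofReal (hφ p q h2)).trans ?_
    rw [ENNReal.ofReal_mul (by positivity)]
    gcongr
  calc _ ≤ ENNReal.ofReal (unitBallVol n / 2 ^ n) *
        (ENNReal.ofReal (1 + ε) * ediamWith d (U i)) ^ n := by gcongr
    _ = _ := by rw [mul_pow]; ring

lemma hMeasWith_le_volume {α : Type*} {n : ℕ} (hn : n ≠ 0) (d : α → α → ℝ)
    (φ : EuclideanSpace ℝ (Fin n) → α) (hφ : ∀ p q, d (φ p) (φ q) ≤ dist p q)
    (A : Set (EuclideanSpace ℝ (Fin n))) :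
    ENNReal.ofReal (unitBallVol n / 2 ^ n) * hMeasWith d n (φ '' A) ≤ volume A := by
  have hpos : 0 < unitBallVol n :=
    ENNReal.toReal_pos (Metric.measure_ball_pos _ _ one_pos).ne' measure_ball_lt_top.ne
  have hc0 : ENNReal.ofReal (unitBallVol n / 2 ^ n) ≠ 0 := by
    rw [Ne, ENNReal.ofReal_eq_zero, not_le]
    positivity
  rw [mul_comm, ← ENNReal.le_div_iff_mul_le (Or.inl hc0) (Or.inl ENNReal.ofReal_ne_top)]
  refine iSup₂_le fun δ hδ => ?_
  rw [ENNReal.le_div_iff_mul_le (Or.inl hc0) (Or.inl ENNReal.ofReal_ne_top)]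
  refine ENNReal.le_of_forall_pos_le_add fun ε hε _ => ?_
  obtain ⟨t, r, htc, -, htr, hcov, hsum⟩ := Besicovitch.exists_closedBall_covering_tsum_measure_le
    (volume : Measure (EuclideanSpace ℝ (Fin n))) (ε := ε) (by exact_mod_cast hε.ne')
    (fun _ => Ioo 0 (δ / 2)) A (fun x _ η hη => by
      obtain ⟨z, hz⟩ := exists_between (lt_min (half_pos hδ) hη)
      exact ⟨z, ⟨hz.1, hz.2.trans_le (min_le_left _ _)⟩, hz.1, hz.2.trans_le (min_le_right _ _)⟩)
  have hdiam : ∀ x ∈ t, ediamWith d (φ '' Metric.closedBall x (r x)) ≤ ENNReal.ofReal (2 * r x) := by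
    intro x _
    simp only [ediamWith, iSup_le_iff, forall_mem_image]
    intro p hp q hq
    refine ENNReal.ofReal_le_ofReal ((hφ p q).trans ((dist_triangle_right p q x).trans ?_))
    linarith [Metric.mem_closedBall.1 hp, Metric.mem_closedBall.1 hq]
  refine le_trans ?_ hsum
  have := htc.to_subtype
  obtain ⟨f, hf⟩ := exists_injective_nat t
  let U : ℕ → Set α := fun k => ⋃ x : t, ⋃ (_ : f x = k), φ '' Metric.closedBall x.1 (r x)
  have hUf : ∀ x : t, U (f x) = φ '' Metric.closedBall x.1 (r x) := by
    intro x
    ext y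
    simp only [U, mem_iUnion, exists_prop, hf.eq_iff]
    exact ⟨fun ⟨z, hz, hy⟩ => hz ▸ hy, fun hy => ⟨x, rfl, hy⟩⟩
  have hUe : ∀ k ∉ range f, ediamWith d (U k) = 0 := by
    intro k hk
    have : U k = ∅ := by
      simp only [U, iUnion_eq_empty]
      exact fun x hx => (hk ⟨x, hx⟩).elim
    simp [this, ediamWith]
  have hle : (⨅ (U : ℕ → Set α) (_ : φ '' A ⊆ ⋃ i, U i)
      (_ : ∀ i, ediamWith d (U i) ≤ ENNReal.ofReal δ), ∑' i, ediamWith d (U i) ^ n) ≤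
      ∑' i, ediamWith d (U i) ^ n := by
    refine iInf_le_of_le U (iInf_le_of_le ?_ (iInf_le_of_le ?_ le_rfl))
    · rintro _ ⟨p, hp, rfl⟩
      obtain ⟨x, hx, hpx⟩ := mem_iUnion₂.1 (hcov hp)
      exact mem_iUnion.2 ⟨f ⟨x, hx⟩, by rw [hUf]; exact mem_image_of_mem _ hpx⟩
    · intro k
      by_cases hk : k ∈ range f
      · obtain ⟨x, rfl⟩ := hk
        rw [hUf]
        refine (hdiam x x.2).trans (ENNReal.ofReal_le_ofReal ?_)
        linarith [(htr x x.2).2]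
      · simp [hUe k hk]
  calc _ ≤ (∑' i, ediamWith d (U i) ^ n) * ENNReal.ofReal (unitBallVol n / 2 ^ n) := by
        gcongr
    _ = (∑' x : t, ediamWith d (U (f x)) ^ n) * ENNReal.ofReal (unitBallVol n / 2 ^ n) := by
        congr 1
        refine (hf.tsum_eq fun k hk => ?_).symm
        by_contra hk'
        exact hk (by simp [hUe k hk', hn])
    _ = ∑' x : t, ediamWith d (U (f x)) ^ n * ENNReal.ofReal (unitBallVol n / 2 ^ n) :=
        ENNReal.tsum_mul_right.symm
    _ ≤ _ := by
        refine ENNReal.tsum_le_tsum fun x => ?_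
        have hr := (htr x x.2).1
        rw [Measure.addHaar_closedBall _ _ hr.le, finrank_euclideanSpace_fin, hUf,
          ← ENNReal.ofReal_toReal (measure_ball_lt_top (x := (0 : EuclideanSpace ℝ (Fin n)))).ne]
        calc _ ≤ ENNReal.ofReal (2 * r x) ^ n * ENNReal.ofReal (unitBallVol n / 2 ^ n) := by
              gcongr
              exact hdiam x x.2
          _ = _ := by
              rw [← ENNReal.ofReal_pow (by positivity), ← ENNReal.ofReal_mul (by positivity),
                ← ENNReal.ofReal_mul (by positivity), unitBallVol, mul_pow]
              congr 1
              field_simp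

/-- If `φ` does not increase distances and is infinitesimally isometric, then the normalized
Hausdorff measure of an image under `φ` is the Lebesgue measure. -/
lemma hMeasWith_image_eq_volume {α : Type*} {n : ℕ} (hn : n ≠ 0) (d : α → α → ℝ)
    (φ : EuclideanSpace ℝ (Fin n) → α) (hφ : ∀ p q, d (φ p) (φ q) ≤ dist p q)
    (hφ' : ∀ ε > 0, ∃ δ > 0, ∀ p q, d (φ p) (φ q) ≤ δ → dist p q ≤ (1 + ε) * d (φ p) (φ q))
    (A : Set (EuclideanSpace ℝ (Fin n))) :
    ENNReal.ofReal (unitBallVol n / 2 ^ n) * hMeasWith d n (φ '' A) = volume A := by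
  refine le_antisymm (hMeasWith_le_volume hn d φ hφ A) ?_
  set c := ENNReal.ofReal (unitBallVol n / 2 ^ n) * hMeasWith d n (φ '' A)
  have h1 : ∀ᶠ ε : ℝ in 𝓝[>] 0, volume A ≤ ENNReal.ofReal (1 + ε) ^ n * c := by
    filter_upwards [self_mem_nhdsWithin] with ε hε
    obtain ⟨δ, hδ, h⟩ := hφ' ε hε
    exact volume_le_hMeasWith hn d φ hε hδ h A
  have h2 : Tendsto (fun ε : ℝ => ENNReal.ofReal (1 + ε) ^ n * c) (𝓝[>] 0) (𝓝 c) := by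
    have h3 : Tendsto (fun ε : ℝ => ENNReal.ofReal ((1 + ε) ^ n)) (𝓝[>] 0) (𝓝 1) := by
      have : Continuous fun ε : ℝ => ENNReal.ofReal ((1 + ε) ^ n) :=
        ENNReal.continuous_ofReal.comp (by fun_prop)
      simpa using (this.tendsto 0).mono_left nhdsWithin_le_nhds
    have h4 := ENNReal.Tendsto.mul_const (b := c) h3 (Or.inl one_ne_zero)
    rw [one_mul] at h4
    refine h4.congr' ?_
    filter_upwards [self_mem_nhdsWithin] with ε hε
    rw [ENNReal.ofReal_pow (by linarith [mem_Ioi.1 hε])]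
  exact ge_of_tendsto h2 h1

/-- `L` is a linear isometry of `ℝⁿ` onto the orthogonal complement of the unit vector `e`. -/
structure IsHoroFrame {n : ℕ} (e : Fin (n + 1) → ℝ)
    (L : EuclideanSpace ℝ (Fin n) →ₗ[ℝ] (Fin (n + 1) → ℝ)) : Prop where
  mem_sph : e ∈ sph n
  inner_eq : ∀ p q, ∑ i, L p i * L q i = inner ℝ p q
  orth : ∀ p, ∑ i, L p i * e i = 0
  surj : ∀ y, ∃ (τ : ℝ) (p : EuclideanSpace ℝ (Fin n)), τ • e + L p = y

lemma exists_isHoroFrame {n : ℕ} {e : Fin (n + 1) → ℝ} (he : e ∈ sph n) :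
    ∃ (L : EuclideanSpace ℝ (Fin n) →ₗ[ℝ] (Fin (n + 1) → ℝ))
      (ψ : (ℝ × EuclideanSpace ℝ (Fin n)) ≃ᵐ (Fin (n + 1) → ℝ)),
      IsHoroFrame e L ∧ (∀ z, ψ z = z.1 • e + L z.2) ∧ MeasurePreserving ψ := by
  obtain ⟨b, hb⟩ := Orthonormal.exists_orthonormalBasis_extension_of_card_eq (𝕜 := ℝ)
    (E := EuclideanSpace ℝ (Fin (n + 1))) (ι := Fin (n + 1)) (by simp)
    (v := fun _ => WithLp.toLp 2 e) (s := {0}) (by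
      constructor
      · intro i
        rw [Set.domRestrict_apply, EuclideanSpace.norm_eq]
        simpa using (show ∑ i, e i ^ 2 = 1 from he)
      · intro i j hij
        exact (hij (Subsingleton.elim _ _)).elim)
  have hb0 : b 0 = WithLp.toLp 2 e := hb 0 rfl
  let L : EuclideanSpace ℝ (Fin n) →ₗ[ℝ] (Fin (n + 1) → ℝ) :=
    { toFun := fun p => (b.repr.symm (WithLp.toLp 2 (Fin.cons 0 p.ofLp))).ofLp
      map_add' := fun p q => by
        have h : (WithLp.toLp 2 (Fin.cons 0 (p + q).ofLp) : EuclideanSpace ℝ (Fin (n + 1))) =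
            WithLp.toLp 2 (Fin.cons 0 p.ofLp) + WithLp.toLp 2 (Fin.cons 0 q.ofLp) := by
          ext i
          refine Fin.cases ?_ (fun j => ?_) i <;> simp
        rw [h, map_add]
        rfl
      map_smul' := fun c p => by
        have h : (WithLp.toLp 2 (Fin.cons 0 (c • p).ofLp) : EuclideanSpace ℝ (Fin (n + 1))) =
            c • WithLp.toLp 2 (Fin.cons 0 p.ofLp) := by
          ext i
          refine Fin.cases ?_ (fun j => ?_) i <;> simp
        rw [h, map_smul]
        rfl }
  let ψ : (ℝ × EuclideanSpace ℝ (Fin n)) ≃ᵐ (Fin (n + 1) → ℝ) :=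
    ((((MeasurableEquiv.refl ℝ).prodCongr (MeasurableEquiv.toLp 2 (Fin n → ℝ)).symm).trans
      (MeasurableEquiv.piFinSuccAbove (fun _ => ℝ) 0).symm).trans
      (MeasurableEquiv.toLp 2 (Fin (n + 1) → ℝ))).trans
      (b.repr.symm.toHomeomorph.toMeasurableEquiv.trans
        (MeasurableEquiv.toLp 2 (Fin (n + 1) → ℝ)).symm)
  have hψ : ∀ z, ψ z = (b.repr.symm (WithLp.toLp 2 (Fin.cons z.1 z.2.ofLp))).ofLp := by
    intro z
    change (b.repr.symm (WithLp.toLp 2 (Fin.insertNth 0 z.1 z.2.ofLp))).ofLp = _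
    rw [Fin.insertNth_zero']
  have hinner : ∀ x y : EuclideanSpace ℝ (Fin (n + 1)), ∑ i, x i * y i = inner ℝ x y := by
    intro x y
    simp [PiLp.inner_apply, mul_comm]
  have hψL : ∀ z, ψ z = z.1 • e + L z.2 := by
    intro z
    rw [hψ]
    have h1 : (WithLp.toLp 2 (Fin.cons z.1 z.2.ofLp) : EuclideanSpace ℝ (Fin (n + 1))) =
        z.1 • EuclideanSpace.single 0 1 + WithLp.toLp 2 (Fin.cons 0 z.2.ofLp) := by
      ext i
      refine Fin.cases ?_ (fun j => ?_) i <;> simp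
    rw [h1, map_add, map_smul, OrthonormalBasis.repr_symm_single, hb0]
    rfl
  refine ⟨L, ψ, ⟨he, fun p q => ?_, fun p => ?_, fun y => ?_⟩, hψL, ?_⟩
  · refine (hinner _ _).trans ?_
    rw [LinearIsometryEquiv.inner_map_map, ← hinner]
    simp [Fin.sum_univ_succ, PiLp.inner_apply, mul_comm]
  · refine (hinner _ (WithLp.toLp 2 e)).trans ?_
    rw [← hb0, real_inner_comm, ← OrthonormalBasis.repr_apply_apply]
    simp
  · obtain ⟨z, rfl⟩ := ψ.surjective y
    exact ⟨z.1, z.2, (hψL z).symm⟩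
  · have h1 := (MeasurePreserving.id (volume : Measure ℝ)).prod
      (EuclideanSpace.volume_preserving_symm_measurableEquiv_toLp (Fin n))
    have h2 := (volume_preserving_piFinSuccAbove (fun _ : Fin (n + 1) => ℝ) 0).symm
    have h3 := PiLp.volume_preserving_toLp (Fin (n + 1))
    have h4 := b.repr.symm.measurePreserving
    have h5 := EuclideanSpace.volume_preserving_symm_measurableEquiv_toLp (Fin (n + 1))
    exact h5.comp (h4.comp (h3.comp (h2.comp h1)))

/-- The point of the horosphere `H_e(s)` with flat coordinate `p`, where `L` is an isometry onto
the orthogonal complement of `e`. -/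
def horoPt {n : ℕ} (e : Fin (n + 1) → ℝ) (L : EuclideanSpace ℝ (Fin n) →ₗ[ℝ] (Fin (n + 1) → ℝ))
    (s : ℝ) (p : EuclideanSpace ℝ (Fin n)) : Fin (n + 2) → ℝ :=
  Fin.snoc ((((1 + ‖p‖ ^ 2) * exp (-s) - exp s) / 2) • e + L p)
    (((1 + ‖p‖ ^ 2) * exp (-s) + exp s) / 2)

section Coordinates

variable {n : ℕ} {e : Fin (n + 1) → ℝ} {L : EuclideanSpace ℝ (Fin n) →ₗ[ℝ] (Fin (n + 1) → ℝ)}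

lemma sum_smul_add_mul (f : Fin (n + 1) → ℝ) (τ : ℝ) (p : EuclideanSpace ℝ (Fin n)) :
    ∑ i, (τ • e + L p) i * f i = τ * ∑ i, e i * f i + ∑ i, L p i * f i := by
  rw [Finset.mul_sum, ← Finset.sum_add_distrib]
  refine Finset.sum_congr rfl fun i _ => ?_
  simp only [Pi.add_apply, Pi.smul_apply, smul_eq_mul]
  ring

lemma sum_smul_add_mul_smul_add (hF : IsHoroFrame e L) (τ σ : ℝ) (p q : EuclideanSpace ℝ (Fin n)) :
    ∑ i, (τ • e + L p) i * (σ • e + L q) i = τ * σ + inner ℝ p q := by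
  have hee : ∑ i, e i * e i = 1 := by simpa [sph, sq] using hF.mem_sph
  have h : ∀ (u v : Fin (n + 1) → ℝ), ∑ i, u i * v i = ∑ i, v i * u i := fun u v =>
    Finset.sum_congr rfl fun i _ => mul_comm _ _
  rw [sum_smul_add_mul, h e, h (L p), sum_smul_add_mul, sum_smul_add_mul, hee, hF.orth, h e, hF.orth, hF.inner_eq,
    real_inner_comm]
  ring

lemma lprod_horoPt_dir (f : Fin (n + 1) → ℝ) (s : ℝ) (p : EuclideanSpace ℝ (Fin n)) :
    lprod n (horoPt e L s p) (dir f) =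
      ((1 + ‖p‖ ^ 2) * exp (-s) - exp s) / 2 * ∑ i, e i * f i + ∑ i, L p i * f i -
        ((1 + ‖p‖ ^ 2) * exp (-s) + exp s) / 2 := by
  simp only [lprod, horoPt, dir, Fin.snoc_castSucc, Fin.snoc_last, mul_one]
  rw [sum_smul_add_mul]

lemma lprod_horoPt_dir_self (hF : IsHoroFrame e L) (s : ℝ)
    (p : EuclideanSpace ℝ (Fin n)) : lprod n (horoPt e L s p) (dir e) = -exp s := by
  have hee : ∑ i, e i * e i = 1 := by simpa [sph, sq] using hF.mem_sph
  rw [lprod_horoPt_dir, hee, hF.orth]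
  ring

lemma lprod_horoPt_horoPt (hF : IsHoroFrame e L) (s s' : ℝ) (p p' : EuclideanSpace ℝ (Fin n)) :
    -lprod n (horoPt e L s p) (horoPt e L s' p') =
      cosh (s - s') + exp (s' - s) / 2 * ‖p - exp (s - s') • p'‖ ^ 2 := by
  simp only [lprod, horoPt, Fin.snoc_castSucc, Fin.snoc_last]
  rw [sum_smul_add_mul_smul_add hF, norm_sub_sq_real, norm_smul, inner_smul_right,
    Real.norm_eq_abs, abs_exp, cosh_eq, neg_sub s s', exp_sub, exp_sub, exp_neg, exp_neg]
  have h1 := exp_ne_zero s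
  have h2 := exp_ne_zero s'
  field_simp
  ring

lemma horoPt_mem_Hyp (hF : IsHoroFrame e L) (s : ℝ) (p : EuclideanSpace ℝ (Fin n)) :
    horoPt e L s p ∈ Hyp n := by
  constructor
  · have h := lprod_horoPt_horoPt hF s s p p
    simp only [sub_self, cosh_zero, exp_zero, one_smul, norm_zero] at h
    linarith
  · rw [horoPt, Fin.snoc_last]
    positivity

lemma snoc_sqrt_eq_horoPt (hF : IsHoroFrame e L) (s : ℝ) (p : EuclideanSpace ℝ (Fin n))
    {y : Fin (n + 1) → ℝ} (hy : y = (((1 + ‖p‖ ^ 2) * exp (-s) - exp s) / 2) • e + L p) :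
    √(1 + ∑ i, y i ^ 2) = ((1 + ‖p‖ ^ 2) * exp (-s) + exp s) / 2 ∧
      (Fin.snoc y √(1 + ∑ i, y i ^ 2) : Fin (n + 2) → ℝ) = horoPt e L s p := by
  have h : √(1 + ∑ i, y i ^ 2) = ((1 + ‖p‖ ^ 2) * exp (-s) + exp s) / 2 := by
    rw [hy]
    simp only [sq (_ : ℝ)]
    rw [sum_smul_add_mul_smul_add hF, Real.sqrt_eq_iff_mul_self_eq_of_pos (by positivity),
      real_inner_self_eq_norm_sq, exp_neg]
    have h1 := exp_ne_zero s
    field_simp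
    ring
  exact ⟨h, by rw [h, hy]; rfl⟩

lemma exists_eq_exp_neg_sub_exp {c : ℝ} (hc : 0 < c) (τ : ℝ) :
    τ = (c * exp (-log (√(c + τ ^ 2) - τ)) - exp (log (√(c + τ ^ 2) - τ))) / 2 := by
  have h0 : 0 < √(c + τ ^ 2) - τ := by
    rw [sub_pos]
    exact Real.lt_sqrt_of_sq_lt (by linarith)
  have h1 : √(c + τ ^ 2) ^ 2 = c + τ ^ 2 := Real.sq_sqrt (by positivity)
  rw [exp_neg, exp_log h0, eq_div_iff two_ne_zero, eq_sub_iff_add_eq, ← div_eq_mul_inv,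
    eq_div_iff h0.ne']
  linear_combination h1

lemma exists_eq_horoPt (hF : IsHoroFrame e L)
    {X : Fin (n + 2) → ℝ} (hX : X ∈ Hyp n) : ∃ s p, X = horoPt e L s p := by
  obtain ⟨τ, p, h⟩ := hF.surj (fun i => X i.castSucc)
  have hc : (0 : ℝ) < 1 + ‖p‖ ^ 2 := by positivity
  rw [exists_eq_exp_neg_sub_exp hc τ] at h
  refine ⟨log (√(1 + ‖p‖ ^ 2 + τ ^ 2) - τ), p, ?_⟩
  rw [← (snoc_sqrt_eq_horoPt hF _ p h.symm).2]
  funext i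
  refine Fin.lastCases ?_ (fun j => ?_) i
  · rw [Fin.snoc_last, eq_comm, Real.sqrt_eq_iff_mul_self_eq_of_pos hX.2]
    have h1 := hX.1
    simp only [lprod] at h1
    simp only [sq]
    linarith
  · rw [Fin.snoc_castSucc]

lemma dH_eq_arcosh (X Y : Fin (n + 2) → ℝ) : dH n X Y = arcosh (-lprod n X Y) := by
  rw [dH, arcosh, neg_sq]

lemma one_le_neg_lprod_horoPt (hF : IsHoroFrame e L) (s s' : ℝ)
    (p p' : EuclideanSpace ℝ (Fin n)) :
    1 ≤ -lprod n (horoPt e L s p) (horoPt e L s' p') := by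
  rw [lprod_horoPt_horoPt hF]
  have := one_le_cosh (s - s')
  have : 0 ≤ exp (s' - s) / 2 * ‖p - exp (s - s') • p'‖ ^ 2 := by positivity
  linarith

lemma dH_horoPt_le_dH_horoPt (hF : IsHoroFrame e L) {s s' s'' : ℝ}
    {p p' p'' : EuclideanSpace ℝ (Fin n)} :
    dH n (horoPt e L s p) (horoPt e L s'' p'') ≤ dH n (horoPt e L s' p') (horoPt e L s'' p'') ↔
      -lprod n (horoPt e L s p) (horoPt e L s'' p'') ≤
        -lprod n (horoPt e L s' p') (horoPt e L s'' p'') := by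
  rw [dH_eq_arcosh, dH_eq_arcosh, arcosh_le_arcosh]
  · exact one_pos.trans_le (one_le_neg_lprod_horoPt hF _ _ _ _)
  · exact one_pos.trans_le (one_le_neg_lprod_horoPt hF _ _ _ _)

lemma abs_sub_le_dH_horoPt (hF : IsHoroFrame e L) (s s' : ℝ) (p p' : EuclideanSpace ℝ (Fin n)) :
    |s - s'| ≤ dH n (horoPt e L s p) (horoPt e L s' p') := by
  rw [dH_eq_arcosh, ← arcosh_cosh (abs_nonneg (s - s')), cosh_abs,
    arcosh_le_arcosh (cosh_pos _) (one_pos.trans_le (one_le_neg_lprod_horoPt hF _ _ _ _)),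
    lprod_horoPt_horoPt hF]
  have : 0 ≤ exp (s' - s) / 2 * ‖p - exp (s - s') • p'‖ ^ 2 := by positivity
  linarith

lemma dH_horoPt_of_eq_smul (hF : IsHoroFrame e L) {s s' : ℝ} {p p' : EuclideanSpace ℝ (Fin n)}
    (h : p = exp (s - s') • p') : dH n (horoPt e L s p) (horoPt e L s' p') = |s - s'| := by
  rw [dH_eq_arcosh, lprod_horoPt_horoPt hF, ← h, sub_self, norm_zero, ← cosh_abs (s - s'),
    zero_pow two_ne_zero, mul_zero, add_zero, arcosh_cosh (abs_nonneg _)]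

lemma dH_horoPt_same (hF : IsHoroFrame e L) (s : ℝ) (p q : EuclideanSpace ℝ (Fin n)) :
    dH n (horoPt e L s p) (horoPt e L s q) = 2 * arsinh (dist p q / 2) := by
  have h : 0 ≤ arsinh (dist p q / 2) := arsinh_nonneg_iff.2 (by positivity)
  rw [dH_eq_arcosh, lprod_horoPt_horoPt hF, sub_self, exp_zero, one_smul, cosh_zero, ← dist_eq_norm,
    ← arcosh_cosh (x := 2 * arsinh (dist p q / 2)) (by positivity), cosh_two_mul, cosh_sq,
    sinh_arsinh]
  congr 1
  ring

lemma dH_horoPt_same_le_dist (hF : IsHoroFrame e L) (s : ℝ) (p q : EuclideanSpace ℝ (Fin n)) :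
    dH n (horoPt e L s p) (horoPt e L s q) ≤ dist p q := by
  have h : arsinh (dist p q / 2) ≤ dist p q / 2 := by
    rw [← sinh_le_sinh, sinh_arsinh, self_le_sinh_iff]
    positivity
  rw [dH_horoPt_same hF]
  linarith

lemma exists_sinh_le_one_add_mul {ε : ℝ} (hε : 0 < ε) :
    ∃ δ > 0, ∀ x, 0 ≤ x → x ≤ δ → sinh x ≤ (1 + ε) * x := by
  have h := (hasDerivAt_iff_isLittleO.1 (hasDerivAt_sinh 0)).def hε
  obtain ⟨δ, hδ, h⟩ := Metric.eventually_nhds_iff.1 h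
  refine ⟨δ / 2, half_pos hδ, fun x hx hxδ => ?_⟩
  have h1 := h (y := x) (by rw [Real.dist_eq, sub_zero, abs_of_nonneg hx]; linarith)
  simp only [sub_zero, sinh_zero, cosh_zero, smul_eq_mul, mul_one, Real.norm_eq_abs,
    abs_of_nonneg hx] at h1
  linarith [le_abs_self (sinh x - x)]

lemma exists_dist_le_mul_dH_horoPt (hF : IsHoroFrame e L) (s : ℝ) {ε : ℝ} (hε : 0 < ε) :
    ∃ δ > 0, ∀ p q, dH n (horoPt e L s p) (horoPt e L s q) ≤ δ →
      dist p q ≤ (1 + ε) * dH n (horoPt e L s p) (horoPt e L s q) := by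
  obtain ⟨δ, hδ, h⟩ := exists_sinh_le_one_add_mul hε
  refine ⟨δ, hδ, fun p q hpq => ?_⟩
  rw [dH_horoPt_same hF] at hpq ⊢
  have h0 : 0 ≤ arsinh (dist p q / 2) := arsinh_nonneg_iff.2 (by positivity)
  have h1 := h _ h0 (by linarith)
  rw [sinh_arsinh] at h1
  linarith

lemma lprod_dir_neg {f : Fin (n + 1) → ℝ} (hf : f ∈ sph n) {X : Fin (n + 2) → ℝ}
    (hX : X ∈ Hyp n) : lprod n X (dir f) < 0 := by
  have hf' : ∑ i, f i ^ 2 = 1 := hf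
  have h1 : ∑ i : Fin (n + 1), X i.castSucc ^ 2 < X (Fin.last (n + 1)) ^ 2 := by
    have := hX.1
    simp only [lprod, ← sq] at this
    linarith
  have h2 := Finset.sum_mul_sq_le_sq_mul_sq Finset.univ (fun i : Fin (n + 1) => X i.castSucc) f
  rw [hf', mul_one] at h2
  have h3 := lt_of_abs_lt (abs_lt_of_sq_lt_sq (h2.trans_lt h1) hX.2.le)
  simp only [lprod, dir, Fin.snoc_castSucc, Fin.snoc_last, mul_one]
  linarith

lemma mem_horoBallCl_iff {f : Fin (n + 1) → ℝ} (hf : f ∈ sph n) {X : Fin (n + 2) → ℝ}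
    (hX : X ∈ Hyp n) {u : ℝ} : X ∈ horoBallCl n f u ↔ -lprod n X (dir f) ≤ exp u := by
  rw [neg_le]
  exact ⟨fun h => h.2.2, fun h => ⟨hX, lprod_dir_neg hf hX, h⟩⟩

lemma mem_horoSphere_iff (hF : IsHoroFrame e L) {s : ℝ} {X : Fin (n + 2) → ℝ} :
    X ∈ horoSphere n e s ↔ ∃ p, horoPt e L s p = X := by
  constructor
  · rintro ⟨hX, h⟩
    obtain ⟨s', p, rfl⟩ := exists_eq_horoPt hF hX
    rw [lprod_horoPt_dir_self hF, neg_inj, exp_eq_exp] at h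
    exact ⟨p, by rw [h]⟩
  · rintro ⟨p, rfl⟩
    exact ⟨horoPt_mem_Hyp hF s p, lprod_horoPt_dir_self hF s p⟩

lemma neg_lprod_horoPt_dir (f : Fin (n + 1) → ℝ) (s : ℝ) (p : EuclideanSpace ℝ (Fin n)) :
    -lprod n (horoPt e L s p) (dir f) =
      (1 - ∑ i, e i * f i) * exp (-s) / 2 * (1 + ‖p‖ ^ 2) + (1 + ∑ i, e i * f i) * exp s / 2 -
        ∑ i, L p i * f i := by
  rw [lprod_horoPt_dir]
  ring

lemma sum_mul_le_one {f g : Fin (n + 1) → ℝ} (hf : f ∈ sph n) (hg : g ∈ sph n) :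
    ∑ i, f i * g i ≤ 1 := by
  have h := Finset.sum_mul_sq_le_sq_mul_sq Finset.univ f g
  have hf' : ∑ i, f i ^ 2 = 1 := hf
  have hg' : ∑ i, g i ^ 2 = 1 := hg
  rw [hf', hg', mul_one] at h
  exact (abs_le_one_iff_mul_self_le_one.2 (by rwa [← sq])) |> le_of_abs_le

lemma convexOn_neg_lprod_horoPt_dir (hF : IsHoroFrame e L) {f : Fin (n + 1) → ℝ}
    (hf : f ∈ sph n) (s : ℝ) :
    ConvexOn ℝ univ fun p => -lprod n (horoPt e L s p) (dir f) := by
  simp only [neg_lprod_horoPt_dir]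
  have h1 : ConvexOn ℝ univ fun p : EuclideanSpace ℝ (Fin n) => 1 + ‖p‖ ^ 2 :=
    (convexOn_const _ convex_univ).add (convexOn_univ_norm.pow (fun _ _ => norm_nonneg _) 2)
  have h2 : 0 ≤ (1 - ∑ i, e i * f i) * exp (-s) / 2 := by
    have := sub_nonneg.2 (sum_mul_le_one hF.mem_sph hf)
    positivity
  have h3 : ConcaveOn ℝ univ fun p : EuclideanSpace ℝ (Fin n) => ∑ i, L p i * f i := by
    refine ⟨convex_univ, fun p _ q _ a b _ _ _ => le_of_eq ?_⟩
    simp only [map_add, map_smul, Pi.add_apply, Pi.smul_apply, smul_eq_mul, Finset.mul_sum,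
      ← Finset.sum_add_distrib]
    exact Finset.sum_congr rfl fun i _ => by ring
  exact ((h1.smul h2).add_const _).sub h3

lemma neg_lprod_horoPt_midpoint (f : Fin (n + 1) → ℝ) (s : ℝ) (p v : EuclideanSpace ℝ (Fin n)) :
    √(1 + ‖v‖ ^ 2) * -lprod n
        (horoPt e L (s - log √(1 + ‖v‖ ^ 2)) ((√(1 + ‖v‖ ^ 2))⁻¹ • p)) (dir f) =
      (-lprod n (horoPt e L s (p + v)) (dir f) + -lprod n (horoPt e L s (p - v)) (dir f)) / 2 := by
  have hv : 0 < √(1 + ‖v‖ ^ 2) := by positivity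
  have hsq : √(1 + ‖v‖ ^ 2) ^ 2 = 1 + ‖v‖ ^ 2 := Real.sq_sqrt (by positivity)
  set ρ := √(1 + ‖v‖ ^ 2)
  have h1 := parallelogram_law_with_norm ℝ p v
  have h2 : ∑ i, L (ρ⁻¹ • p) i * f i = ρ⁻¹ * ∑ i, L p i * f i := by
    simp only [map_smul, Pi.smul_apply, smul_eq_mul, Finset.mul_sum, mul_assoc]
  have h3 : ∑ i, L (p + v) i * f i + ∑ i, L (p - v) i * f i = 2 * ∑ i, L p i * f i := by
    rw [← Finset.sum_add_distrib, Finset.mul_sum]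
    refine Finset.sum_congr rfl fun i _ => ?_
    simp only [map_add, map_sub, Pi.add_apply, Pi.sub_apply]
    ring
  have h4 : exp (-(s - log ρ)) = exp (-s) * ρ := by
    rw [neg_sub, sub_eq_neg_add, exp_add, exp_log hv]
  have h5 : exp (s - log ρ) = exp s * ρ⁻¹ := by
    rw [exp_sub, exp_log hv, div_eq_mul_inv]
  simp only [neg_lprod_horoPt_dir]
  rw [h2, h4, h5, norm_smul, norm_inv, Real.norm_eq_abs, abs_of_pos hv]
  field_simp
  linear_combination (2 * (1 - ∑ i, e i * f i) * exp (-s)) * hsq -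
    (1 - ∑ i, e i * f i) * exp (-s) * h1 + 2 * h3

section Polytope

variable {m : ℕ} {f : Fin m → Fin (n + 1) → ℝ} {x : Fin m → ℝ}

lemma horoPt_mem_iInter_horoBallCl_iff (hF : IsHoroFrame e L) (hf : ∀ j, f j ∈ sph n) {s : ℝ}
    {p : EuclideanSpace ℝ (Fin n)} :
    horoPt e L s p ∈ ⋂ j, horoBallCl n (f j) (x j) ↔
      ∀ j, -lprod n (horoPt e L s p) (dir (f j)) ≤ exp (x j) := by
  rw [mem_iInter]
  exact forall_congr' fun j => mem_horoBallCl_iff (hf j) (horoPt_mem_Hyp hF s p)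

lemma convex_preimage_horoPt (hF : IsHoroFrame e L) (hf : ∀ j, f j ∈ sph n) (s : ℝ) :
    Convex ℝ (horoPt e L s ⁻¹' ⋂ j, horoBallCl n (f j) (x j)) := by
  have : horoPt e L s ⁻¹' ⋂ j, horoBallCl n (f j) (x j) =
      ⋂ j, {p ∈ univ | -lprod n (horoPt e L s p) (dir (f j)) ≤ exp (x j)} := by
    ext p
    rw [mem_preimage, horoPt_mem_iInter_horoBallCl_iff hF hf]
    simp
  rw [this]
  exact convex_iInter fun j => (convexOn_neg_lprod_horoPt_dir hF (hf j) s).convex_le _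

lemma horoPt_midpoint_mem (hF : IsHoroFrame e L) (hf : ∀ j, f j ∈ sph n) {s : ℝ}
    {p v : EuclideanSpace ℝ (Fin n)}
    (h₁ : horoPt e L s (p + v) ∈ ⋂ j, horoBallCl n (f j) (x j))
    (h₂ : horoPt e L s (p - v) ∈ ⋂ j, horoBallCl n (f j) (x j)) :
    horoPt e L (s - log √(1 + ‖v‖ ^ 2)) ((√(1 + ‖v‖ ^ 2))⁻¹ • p) ∈
      ⋂ j, horoBallCl n (f j) (x j) := by
  rw [horoPt_mem_iInter_horoBallCl_iff hF hf] at h₁ h₂ ⊢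
  intro j
  have hρ : 1 ≤ √(1 + ‖v‖ ^ 2) := Real.one_le_sqrt.2 (by nlinarith [sq_nonneg ‖v‖])
  have h := neg_lprod_horoPt_midpoint (e := e) (L := L) (f j) s p v
  have h0 : 0 < -lprod n (horoPt e L (s - log √(1 + ‖v‖ ^ 2)) ((√(1 + ‖v‖ ^ 2))⁻¹ • p))
      (dir (f j)) := neg_pos.2 (lprod_dir_neg (hf j) (horoPt_mem_Hyp hF _ _))
  nlinarith [h₁ j, h₂ j, mul_le_mul_of_nonneg_right hρ h0.le]

end Polytope

lemma facet_eq_image (hF : IsHoroFrame e L) {P : Set (Fin (n + 2) → ℝ)} {s₀ : ℝ}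
    (hs₀ : suppFn n P e = s₀) : facet n P e = horoPt e L s₀ '' (horoPt e L s₀ ⁻¹' P) := by
  rw [image_preimage_eq_inter_range, facet, hs₀]
  congr 1
  ext X
  exact mem_horoSphere_iff hF

lemma horoPt_injective (hF : IsHoroFrame e L) (s : ℝ) : Function.Injective (horoPt e L s) := by
  intro p q hpq
  have h := dH_horoPt_same hF s p q
  rw [hpq, dH_horoPt_same hF, dist_self, zero_div, arsinh_zero, mul_zero, eq_comm] at h
  have h1 : arsinh (dist p q / 2) = 0 := by linarith
  rw [arsinh_eq_zero_iff] at h1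
  exact dist_eq_zero.1 (by linarith)

lemma facetRelInt_eq_image (hF : IsHoroFrame e L) {P : Set (Fin (n + 2) → ℝ)} {s₀ : ℝ}
    (hs₀ : suppFn n P e = s₀) :
    facetRelInt n P e = horoPt e L s₀ '' interior (horoPt e L s₀ ⁻¹' P) := by
  have hmem : ∀ p, horoPt e L s₀ p ∈ facet n P e ↔ horoPt e L s₀ p ∈ P := by
    intro p
    rw [facet_eq_image hF hs₀, (horoPt_injective hF s₀).mem_set_image, mem_preimage]
  ext Y
  constructor
  · rintro ⟨hY, δ, hδ, h⟩
    rw [facet_eq_image hF hs₀] at hY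
    obtain ⟨p, -, rfl⟩ := hY
    refine mem_image_of_mem _ (mem_interior_iff_mem_nhds.2 (Metric.mem_nhds_iff.2 ⟨δ, hδ, ?_⟩))
    intro q hq
    refine (hmem q).1 (h _ (hs₀ ▸ (mem_horoSphere_iff hF).2 ⟨q, rfl⟩) ?_)
    exact (dH_horoPt_same_le_dist hF _ _ _).trans_lt (Metric.mem_ball'.1 hq)
  · rintro ⟨p, hp, rfl⟩
    obtain ⟨η, hη, h⟩ := Metric.mem_nhds_iff.1 (mem_interior_iff_mem_nhds.1 hp)
    have hpP : p ∈ horoPt e L s₀ ⁻¹' P := interior_subset hp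
    refine ⟨(hmem p).2 hpP, 2 * arsinh (η / 2),
      mul_pos two_pos (arsinh_pos_iff.2 (half_pos hη)), fun Z hZ hd => ?_⟩
    rw [hs₀] at hZ
    obtain ⟨q, rfl⟩ := (mem_horoSphere_iff hF).1 hZ
    rw [dH_horoPt_same hF, mul_lt_mul_iff_right₀ two_pos, arsinh_lt_arsinh] at hd
    exact (hmem q).2 (h (Metric.mem_ball'.2 (by linarith)))

lemma distTo_eq_of_forall_le {P : Set (Fin (n + 2) → ℝ)} {X Y : Fin (n + 2) → ℝ} (hY : Y ∈ P)
    (h : ∀ Z ∈ P, dH n Y X ≤ dH n Z X) : distTo n P X = dH n Y X :=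
  IsLeast.csInf_eq ⟨mem_image_of_mem _ hY, forall_mem_image.2 h⟩

/-- A nearest point of `A` to `q` that is interior to `A` is equal to `q`. -/
lemma eq_of_mem_interior_of_forall_norm_le {E : Type*} [NormedAddCommGroup E] [NormedSpace ℝ E]
    {A : Set E} {y q : E} (hy : y ∈ interior A) (h : ∀ z ∈ A, ‖y - q‖ ≤ ‖z - q‖) : y = q := by
  have hc : Continuous fun ε : ℝ => y + ε • (q - y) := by fun_prop
  have h0 : ∀ᶠ ε : ℝ in 𝓝 0, y + ε • (q - y) ∈ A :=
    hc.tendsto' 0 y (by simp) (mem_interior_iff_mem_nhds.1 hy)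
  have h1 := h0.filter_mono (nhdsWithin_le_nhds (s := Ioi 0))
  obtain ⟨ε, hεA, hε0, hε1⟩ := (h1.and (Ioo_mem_nhdsGT one_pos)).exists
  have h2 := h _ hεA
  have h3 : y + ε • (q - y) - q = (1 - ε) • (y - q) := by
    module
  rw [h3, norm_smul, Real.norm_eq_abs, abs_of_pos (sub_pos.2 hε1)] at h2
  rw [← sub_eq_zero, ← norm_eq_zero]
  nlinarith [norm_nonneg (y - q)]

lemma mem_collar_horoPt_iff (hn : n ≠ 0) (hF : IsHoroFrame e L) {m : ℕ}
    {f : Fin m → Fin (n + 1) → ℝ} {x : Fin m → ℝ} (hf : ∀ j, f j ∈ sph n)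
    {P : Set (Fin (n + 2) → ℝ)} (hP : P = ⋂ j, horoBallCl n (f j) (x j)) {i : Fin m}
    (hi : f i = e) (hs₀ : suppFn n P e = x i) {t s : ℝ} {p : EuclideanSpace ℝ (Fin n)} :
    horoPt e L s p ∈ collar n P e t ↔ (x i < s ∧ s ≤ x i + t) ∧
      exp (x i - s) • p ∈ interior (horoPt e L (x i) ⁻¹' P) := by
  set s₀ := x i
  set A := horoPt e L s₀ ⁻¹' P
  constructor
  · rintro ⟨-, hpos, hle, Y, hY, hmin⟩
    rw [facetRelInt_eq_image hF hs₀] at hY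
    obtain ⟨y, hy, rfl⟩ := hY
    have hyA : y ∈ A := interior_subset hy
    have hyp : y = exp (s₀ - s) • p := by
      refine eq_of_mem_interior_of_forall_norm_le hy fun z hz => ?_
      have h := hmin _ hz
      rw [dH_horoPt_le_dH_horoPt hF, lprod_horoPt_horoPt hF, lprod_horoPt_horoPt hF,
        add_le_add_iff_left, mul_le_mul_iff_right₀ (by positivity)] at h
      exact (sq_le_sq₀ (norm_nonneg _) (norm_nonneg _)).1 h
    rw [distTo_eq_of_forall_le hyA hmin, dH_horoPt_of_eq_smul hF hyp] at hpos hle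
    suffices hs : s₀ < s by
      rw [abs_of_neg (sub_neg.2 hs)] at hle
      exact ⟨⟨hs, by linarith⟩, hyp ▸ hy⟩
    by_contra! hs
    have hs' : 0 < s₀ - s := by rwa [abs_of_nonneg (sub_nonneg.2 hs)] at hpos
    have hA : A ∈ 𝓝 y := mem_interior_iff_mem_nhds.1 hy
    have : Nonempty (Fin n) := ⟨⟨0, Nat.pos_of_ne_zero hn⟩⟩
    obtain ⟨w, hw⟩ := exists_ne (0 : EuclideanSpace ℝ (Fin n))
    have h1 : ∀ᶠ ε : ℝ in 𝓝 0, y + ε • w ∈ A :=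
      (by fun_prop : Continuous fun ε : ℝ => y + ε • w).tendsto' 0 y (by simp) hA
    have h2 : ∀ᶠ ε : ℝ in 𝓝 0, y - ε • w ∈ A :=
      (by fun_prop : Continuous fun ε : ℝ => y - ε • w).tendsto' 0 y (by simp) hA
    have h3 : ∀ᶠ ε : ℝ in 𝓝 0, log √(1 + ‖ε • w‖ ^ 2) < s₀ - s := by
      have hc : Continuous fun ε : ℝ => log √(1 + ‖ε • w‖ ^ 2) :=
        Continuous.log (by fun_prop) fun ε => by positivity
      exact (hc.tendsto' 0 0 (by simp)).eventually (eventually_lt_nhds hs')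
    obtain ⟨ε, ⟨⟨hε1, hε2⟩, hε3⟩, hε⟩ :=
      ((((h1.and h2).and h3).filter_mono nhdsWithin_le_nhds).and
        (self_mem_nhdsWithin : Ioi (0 : ℝ) ∈ 𝓝[>] 0)).exists
    have hε0 : 0 < ε := hε
    set v := ε • w with hv
    have hv0 : 0 < ‖v‖ := by
      rw [norm_pos_iff]
      exact smul_ne_zero hε0.ne' hw
    have hM : horoPt e L (s₀ - log √(1 + ‖v‖ ^ 2)) ((√(1 + ‖v‖ ^ 2))⁻¹ • y) ∈ P := by
      have ha : horoPt e L s₀ (y + v) ∈ P := hε1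
      have hb : horoPt e L s₀ (y - v) ∈ P := hε2
      rw [hP] at ha hb ⊢
      exact horoPt_midpoint_mem hF hf ha hb
    have hρ : 1 < √(1 + ‖v‖ ^ 2) := by
      rw [Real.lt_sqrt zero_le_one]
      nlinarith [sq_pos_of_pos hv0]
    have hlog : 0 < log √(1 + ‖v‖ ^ 2) := log_pos hρ
    have h := hmin _ hM
    rw [dH_horoPt_of_eq_smul hF hyp, dH_horoPt_of_eq_smul hF, abs_of_pos hs', abs_of_pos] at h
    · linarith
    · linarith
    · rw [hyp, smul_smul, sub_right_comm, exp_sub (s₀ - s), exp_log (by positivity), div_eq_inv_mul]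
  · rintro ⟨⟨hs, hst⟩, hy⟩
    set y := exp (s₀ - s) • p with hyp
    have hyA : y ∈ A := interior_subset hy
    have hd : dH n (horoPt e L s₀ y) (horoPt e L s p) = s - s₀ := by
      rw [dH_horoPt_of_eq_smul hF hyp, abs_sub_comm, abs_of_pos (sub_pos.2 hs)]
    have hmin : ∀ Z ∈ P, dH n (horoPt e L s₀ y) (horoPt e L s p) ≤ dH n Z (horoPt e L s p) := by
      intro Z hZ
      rw [hP] at hZ
      have hZi := mem_iInter.1 hZ i
      obtain ⟨s', q, rfl⟩ := exists_eq_horoPt hF hZi.1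
      rw [mem_horoBallCl_iff (hf i) hZi.1, hi, lprod_horoPt_dir_self hF, neg_neg, exp_le_exp] at hZi
      rw [hd]
      refine le_trans ?_ (abs_sub_le_dH_horoPt hF _ _ _ _)
      rw [abs_sub_comm]
      exact le_trans (by linarith) (le_abs_self _)
    have hdist := (distTo_eq_of_forall_le hyA hmin).trans hd
    refine ⟨horoPt_mem_Hyp hF _ _, by rw [hdist]; linarith, by rw [hdist]; linarith,
      horoPt e L s₀ y, ?_, hmin⟩
    rw [facetRelInt_eq_image hF hs₀]
    exact mem_image_of_mem _ hy

lemma lintegral_comp_exp_neg_sub_exp {c : ℝ} (hc : 0 < c) (g : ℝ → ℝ≥0∞) :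
    ∫⁻ τ, g τ = ∫⁻ s, ENNReal.ofReal ((c * exp (-s) + exp s) / 2) *
      g ((c * exp (-s) - exp s) / 2) := by
  have hd : ∀ s : ℝ, HasDerivAt (fun s => (c * exp (-s) - exp s) / 2)
      (-((c * exp (-s) + exp s) / 2)) s := by
    intro s
    refine ((((hasDerivAt_neg s).exp.const_mul c).sub (Real.hasDerivAt_exp s)).div_const
      2).congr_deriv ?_
    ring
  have hanti : StrictAnti fun s : ℝ => (c * exp (-s) - exp s) / 2 :=
    strictAnti_of_hasDerivAt_neg hd fun s => neg_neg_of_pos (by positivity)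
  have himage : (fun s : ℝ => (c * exp (-s) - exp s) / 2) '' univ = univ := by
    rw [image_univ]
    exact range_eq_univ.2 fun τ => ⟨_, (exists_eq_exp_neg_sub_exp hc τ).symm⟩
  have h := lintegral_image_eq_lintegral_abs_deriv_mul MeasurableSet.univ
    (fun s _ => (hd s).hasDerivWithinAt) hanti.injective.injOn g
  rw [himage, Measure.restrict_univ] at h
  rw [h]
  refine lintegral_congr fun s => ?_
  rw [abs_neg, abs_of_pos (by positivity)]

/-- In horospherical coordinates the hyperbolic volume is Lebesgue measure. -/
lemma hypVol_eq_volume (hF : IsHoroFrame e L)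
    {ψ : (ℝ × EuclideanSpace ℝ (Fin n)) ≃ᵐ (Fin (n + 1) → ℝ)} (hψL : ∀ z, ψ z = z.1 • e + L z.2)
    (hψ : MeasurePreserving ψ) {K : Set (Fin (n + 2) → ℝ)}
    {D : Set (ℝ × EuclideanSpace ℝ (Fin n))} (hD : MeasurableSet D)
    (hK : ∀ s p, horoPt e L s p ∈ K ↔ (s, p) ∈ D) : hypVol n K = (volume D).toReal := by
  set G : ℝ × EuclideanSpace ℝ (Fin n) → ℝ :=
    {z | (log (√(1 + ‖z.2‖ ^ 2 + z.1 ^ 2) - z.1), z.2) ∈ D}.indicator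
      fun z => 1 / √(1 + ‖z.2‖ ^ 2 + z.1 ^ 2) with hG
  have hGm : Measurable G :=
    Measurable.indicator (by fun_prop) (hD.preimage (by fun_prop))
  have hG0 : ∀ z, 0 ≤ G z := fun z => indicator_nonneg (fun _ _ => by positivity) _
  have hsqrt : ∀ (s : ℝ) (p : EuclideanSpace ℝ (Fin n)),
      √(1 + ‖p‖ ^ 2 + (((1 + ‖p‖ ^ 2) * exp (-s) - exp s) / 2) ^ 2) =
        ((1 + ‖p‖ ^ 2) * exp (-s) + exp s) / 2 := by
    intro s p
    rw [Real.sqrt_eq_iff_mul_self_eq_of_pos (by positivity), exp_neg]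
    have h1 := exp_ne_zero s
    field_simp
    ring
  have hGs : ∀ (s : ℝ) (p : EuclideanSpace ℝ (Fin n)),
      G (((1 + ‖p‖ ^ 2) * exp (-s) - exp s) / 2, p) =
        D.indicator (fun _ => 1 / (((1 + ‖p‖ ^ 2) * exp (-s) + exp s) / 2)) (s, p) := by
    intro s p
    have hlog : log (((1 + ‖p‖ ^ 2) * exp (-s) + exp s) / 2 -
        ((1 + ‖p‖ ^ 2) * exp (-s) - exp s) / 2) = s := by
      rw [← log_exp s]
      congr 1
      rw [log_exp]
      ring
    simp only [hG, indicator, mem_ofPred_eq, hsqrt]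
    congr 1
    rw [hsqrt, hlog]
  have hGψ : ∀ z, indicator {y : Fin (n + 1) → ℝ | Fin.snoc y (√(1 + ∑ i, y i ^ 2)) ∈ K}
      (fun y => 1 / √(1 + ∑ i, y i ^ 2)) (ψ z) = G z := by
    rintro ⟨τ, p⟩
    have hc : (0 : ℝ) < 1 + ‖p‖ ^ 2 := by positivity
    rw [exists_eq_exp_neg_sub_exp hc τ]
    generalize log (√(1 + ‖p‖ ^ 2 + τ ^ 2) - τ) = s
    obtain ⟨h1, h2⟩ := snoc_sqrt_eq_horoPt hF s p
      (hψL (((1 + ‖p‖ ^ 2) * exp (-s) - exp s) / 2, p))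
    rw [hGs]
    simp only [indicator, mem_ofPred_eq, ← h1]
    congr 1
    rw [h2, hK]
  rw [hypVol, ← hψ.integral_comp', integral_congr_ae (ae_of_all _ hGψ),
    integral_eq_lintegral_of_nonneg_ae (ae_of_all _ hG0) hGm.aestronglyMeasurable]
  congr 1
  rw [Measure.volume_eq_prod, lintegral_prod_symm' _ hGm.ennreal_ofReal,
    Measure.prod_apply_symm hD]
  refine lintegral_congr fun p => ?_
  rw [lintegral_comp_exp_neg_sub_exp (by positivity : (0 : ℝ) < 1 + ‖p‖ ^ 2),
    ← lintegral_indicator_one (hD.preimage measurable_prodMk_right)]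
  refine lintegral_congr fun s => ?_
  rw [hGs]
  by_cases h : (s, p) ∈ D
  · have hs : s ∈ (fun x => (x, p)) ⁻¹' D := h
    rw [indicator_of_mem h, indicator_of_mem hs, ← ENNReal.ofReal_mul (by positivity),
      mul_one_div_cancel (by positivity), ENNReal.ofReal_one, Pi.one_apply]
  · have hs : s ∉ (fun x => (x, p)) ⁻¹' D := h
    rw [indicator_of_notMem h, indicator_of_notMem hs, ENNReal.ofReal_zero, mul_zero]

lemma lintegral_Ioc_exp {n : ℕ} (hn : n ≠ 0) (s₀ : ℝ) {t : ℝ} (ht : 0 ≤ t) :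
    ∫⁻ s in Ioc s₀ (s₀ + t), ENNReal.ofReal (exp (n * (s - s₀))) =
      ENNReal.ofReal ((exp (n * t) - 1) / n) := by
  have hn' : (n : ℝ) ≠ 0 := Nat.cast_ne_zero.2 hn
  have hd : ∀ s : ℝ, HasDerivAt (fun s => exp (n * (s - s₀)) / n) (exp (n * (s - s₀))) s := by
    intro s
    refine ((((hasDerivAt_id s).sub_const s₀).const_mul (n : ℝ)).exp.div_const
      (n : ℝ)).congr_deriv ?_
    rw [mul_one, mul_div_cancel_right₀ _ hn']
    rfl
  have hc : Continuous fun s : ℝ => exp (n * (s - s₀)) := by fun_prop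
  rw [← ofReal_integral_eq_lintegral_ofReal (hc.integrableOn_Ioc)
      (ae_of_all _ fun s => (exp_pos _).le), ← intervalIntegral.integral_of_le (by linarith),
    intervalIntegral.integral_eq_sub_of_hasDerivAt (fun s _ => hd s)
      (hc.intervalIntegrable _ _)]
  congr 1
  simp [sub_div]

/-- The volume of a cylinder over `U` in horospherical coordinates. -/
lemma volume_smul_mem {n : ℕ} (hn : n ≠ 0) {U : Set (EuclideanSpace ℝ (Fin n))}
    (hU : MeasurableSet U) (s₀ : ℝ) {t : ℝ} (ht : 0 ≤ t) :
    MeasurableSet {z : ℝ × EuclideanSpace ℝ (Fin n) |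
        (s₀ < z.1 ∧ z.1 ≤ s₀ + t) ∧ exp (s₀ - z.1) • z.2 ∈ U} ∧
      volume {z : ℝ × EuclideanSpace ℝ (Fin n) |
        (s₀ < z.1 ∧ z.1 ≤ s₀ + t) ∧ exp (s₀ - z.1) • z.2 ∈ U} =
      ENNReal.ofReal ((exp (n * t) - 1) / n) * volume U := by
  have hm : MeasurableSet {z : ℝ × EuclideanSpace ℝ (Fin n) |
      (s₀ < z.1 ∧ z.1 ≤ s₀ + t) ∧ exp (s₀ - z.1) • z.2 ∈ U} := by
    have hg : Measurable fun z : ℝ × EuclideanSpace ℝ (Fin n) => exp (s₀ - z.1) • z.2 := by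
      fun_prop
    exact (measurableSet_Ioc.preimage measurable_fst).inter (hU.preimage hg)
  refine ⟨hm, ?_⟩
  rw [Measure.volume_eq_prod, Measure.prod_apply hm, ← lintegral_Ioc_exp hn s₀ ht,
    ← lintegral_mul_const _ (by fun_prop), ← lintegral_indicator measurableSet_Ioc]
  refine lintegral_congr fun s => ?_
  by_cases hs : s ∈ Ioc s₀ (s₀ + t)
  · rw [indicator_of_mem hs]
    have : Prod.mk s ⁻¹' {z : ℝ × EuclideanSpace ℝ (Fin n) |
        (s₀ < z.1 ∧ z.1 ≤ s₀ + t) ∧ exp (s₀ - z.1) • z.2 ∈ U} =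
        (fun p => exp (s₀ - s) • p) ⁻¹' U := by
      ext p
      exact and_iff_right hs
    rw [this, Measure.addHaar_preimage_smul volume (exp_ne_zero _), finrank_euclideanSpace_fin,
      abs_of_pos (by positivity), ← exp_nat_mul, ← exp_neg, ← mul_neg, neg_sub]
  · rw [indicator_of_notMem hs]
    refine measure_mono_null (fun p hp => hs hp.1) measure_empty

end Coordinates

lemma volume_interior_of_convex {n : ℕ} {A : Set (EuclideanSpace ℝ (Fin n))} (hA : Convex ℝ A) :
    volume (interior A) = volume A := by
  refine le_antisymm (measure_mono interior_subset) ?_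
  calc volume A ≤ volume (interior A ∪ frontier A) :=
        measure_mono (subset_closure.trans (closure_eq_interior_union_frontier A).subset)
    _ ≤ volume (interior A) + volume (frontier A) := measure_union_le _ _
    _ = volume (interior A) := by rw [hA.addHaar_frontier volume, add_zero]

/-- For a h-convex polytope `P = ∩_j B̄_{e_j}(x_j)` with `u(P,e_j) = x_j` and a facet
`F(P,e_i)`, the collar `P_t = 𝒫_t(P,F̊(P,e_i))` has volume
`V(P_t) = ((e^{nt} − 1)/n) · S(P,e_i)` for every `t > 0`. -/
theorem vol_collar_eq (n m : ℕ) (hn : 1 ≤ n) (hm : 2 ≤ m)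
    (e : Fin m → (Fin (n + 1) → ℝ)) (he : ∀ j, e j ∈ sph n)
    (x : Fin m → ℝ) (P : Set (Fin (n + 2) → ℝ))
    (hP : P = ⋂ j, horoBallCl n (e j) (x j))
    (hbody : IsHConvexBody n P)
    (hu : ∀ j, suppFn n P (e j) = x j)
    (i : Fin m) (hfacet : 0 < areaFacet n P (e i)) :
    ∀ t : ℝ, 0 < t →
      hypVol n (collar n P (e i) t) =
        (Real.exp (n * t) - 1) / n * areaFacet n P (e i) := by
  intro t ht
  have hn' : n ≠ 0 := by omega
  obtain ⟨L, ψ, hF, hψL, hψ⟩ := exists_isHoroFrame (he i)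
  obtain ⟨hm', hvol⟩ := volume_smul_mem hn'
    (isOpen_interior (s := horoPt (e i) L (x i) ⁻¹' P)).measurableSet (x i) ht.le
  have hconv : Convex ℝ (horoPt (e i) L (x i) ⁻¹' P) := hP ▸ convex_preimage_horoPt hF he (x i)
  rw [hypVol_eq_volume hF hψL hψ hm' fun s p => mem_collar_horoPt_iff hn' hF he hP rfl (hu i),
    hvol, volume_interior_of_convex hconv, areaFacet, facet_eq_image hF (hu i),
    hMeasWith_image_eq_volume hn' (dH n) (horoPt (e i) L (x i))
      (dH_horoPt_same_le_dist hF (x i)) (fun ε hε => exists_dist_le_mul_dH_horoPt hF (x i) hε),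
    ENNReal.toReal_mul, ENNReal.toReal_ofReal]
  have h1 : 1 ≤ exp (n * t) := one_le_exp (by positivity)
  exact div_nonneg (by linarith) (Nat.cast_nonneg n)

end Horo
end
end

section
/- For every M > 0 there exists a constant C > 0, depending only on M and n, such that every h-convex body K ∈ 𝒦_o^h containing O in its interior with V(K) ≤ M satisfies u(K,e) ≤ C for all e ∈ 𝕊^n. -/
noncomputable section

open Real MeasureTheory Filter Topology Set
open scoped ENNReal symmDiff

namespace Horo

/-- The point of the hyperboloid lying over `y`. -/
def graphPt (n : ℕ) (y : Fin (n + 1) → ℝ) : Fin (n + 2) → ℝ :=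
  Fin.snoc y (Real.sqrt (1 + ∑ i, y i ^ 2))

theorem sum_sq_eq_dotProduct {ι : Type*} [Fintype ι] (y : ι → ℝ) : ∑ i, y i ^ 2 = y ⬝ᵥ y := by
  simp [dotProduct, sq]

theorem dotProduct_self_nonneg_real {ι : Type*} [Fintype ι] (y : ι → ℝ) : 0 ≤ y ⬝ᵥ y := by
  rw [← sum_sq_eq_dotProduct]
  positivity

theorem dotProduct_sq_le {ι : Type*} [Fintype ι] (x y : ι → ℝ) :
    (x ⬝ᵥ y) ^ 2 ≤ (x ⬝ᵥ x) * (y ⬝ᵥ y) := by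
  rw [← sum_sq_eq_dotProduct, ← sum_sq_eq_dotProduct]
  exact Finset.sum_mul_sq_le_sq_mul_sq _ _ _

theorem lprod_dir (n : ℕ) (X : Fin (n + 2) → ℝ) (e : Fin (n + 1) → ℝ) :
    lprod n X (dir e) = Fin.init X ⬝ᵥ e - X (Fin.last (n + 1)) := by
  simp [lprod, dir, dotProduct, Fin.init]

theorem lprod_graphPt_dir (n : ℕ) (y e : Fin (n + 1) → ℝ) :
    lprod n (graphPt n y) (dir e) = y ⬝ᵥ e - Real.sqrt (1 + y ⬝ᵥ y) := by
  rw [lprod_dir, ← sum_sq_eq_dotProduct]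
  simp [graphPt]

theorem graphPt_mem_Hyp (n : ℕ) (y : Fin (n + 1) → ℝ) : graphPt n y ∈ Hyp n := by
  have h : 0 < 1 + ∑ i, y i ^ 2 := by positivity
  refine ⟨?_, by simpa [graphPt] using Real.sqrt_pos.2 h⟩
  simp only [lprod, graphPt, Fin.snoc_castSucc, Fin.snoc_last, Real.mul_self_sqrt h.le, ← sq]
  ring

theorem continuous_graphPt (n : ℕ) : Continuous (graphPt n) := by
  refine continuous_pi fun i => ?_
  refine Fin.lastCases ?_ (fun j => ?_) i
  · simp only [graphPt, Fin.snoc_last]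
    fun_prop
  · simp only [graphPt, Fin.snoc_castSucc]
    fun_prop

theorem graphPt_zero (n : ℕ) : graphPt n 0 = origin n := by
  simp only [graphPt, origin, Pi.zero_apply]
  norm_num
  rfl

theorem init_dotProduct_self {n : ℕ} {X : Fin (n + 2) → ℝ} (hX : X ∈ Hyp n) :
    Fin.init X ⬝ᵥ Fin.init X = X (Fin.last (n + 1)) ^ 2 - 1 := by
  have h := hX.1
  simp only [lprod] at h
  simp only [dotProduct, Fin.init]
  linarith

theorem sqrt_one_add_smul_lt {t q : ℝ} (h0 : 0 < t) (h1 : t < 1) (hq : 0 < q) :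
    Real.sqrt (1 + t ^ 2 * q) < (1 - t) + t * Real.sqrt (1 + q) := by
  have hr : 1 < Real.sqrt (1 + q) := Real.lt_sqrt_of_sq_lt (by linarith)
  have hs : Real.sqrt (1 + q) ^ 2 = 1 + q := Real.sq_sqrt (by linarith)
  refine (Real.sqrt_lt' (by nlinarith)).2 ?_
  have h2 : 0 < t * (1 - t) * (Real.sqrt (1 + q) - 1) :=
    mul_pos (mul_pos h0 (by linarith)) (by linarith)
  nlinarith [hs]

theorem exists_graphPt_smul_mem {n : ℕ} {K : Set (Fin (n + 2) → ℝ)} (hO : origin n ∈ relInt n K)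
    (y : Fin (n + 1) → ℝ) : ∃ t ∈ Ioo (0 : ℝ) 1, graphPt n (t • y) ∈ K := by
  obtain ⟨-, ε, hε, h⟩ := hO
  have hd : ∀ t : ℝ, dH n (origin n) (graphPt n (t • y)) =
      Real.log (Real.sqrt (1 + t ^ 2 * ∑ i, y i ^ 2) +
        Real.sqrt (Real.sqrt (1 + t ^ 2 * ∑ i, y i ^ 2) ^ 2 - 1)) := by
    intro t
    simp [dH, lprod, origin, graphPt, mul_pow, Finset.mul_sum]
  have hc : ContinuousAt (fun t : ℝ => dH n (origin n) (graphPt n (t • y))) 0 := by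
    simp only [hd]
    refine ContinuousAt.log (by fun_prop) ?_
    norm_num
  have h0 : dH n (origin n) (graphPt n ((0 : ℝ) • y)) < ε := by
    rw [hd]
    norm_num
    exact hε
  have hev : ∀ᶠ t in 𝓝[>] (0 : ℝ), dH n (origin n) (graphPt n (t • y)) < ε :=
    nhdsWithin_le_nhds (hc.eventually_lt_const h0)
  have hI : ∀ᶠ t in 𝓝[>] (0 : ℝ), t ∈ Ioo (0 : ℝ) 1 := Ioo_mem_nhdsGT one_pos
  obtain ⟨t, ht, htI⟩ := (hev.and hI).exists
  exact ⟨t, htI, h _ (graphPt_mem_Hyp n _) ht⟩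

theorem origin_mem {n : ℕ} {K : Set (Fin (n + 2) → ℝ)} (hO : origin n ∈ relInt n K) :
    origin n ∈ K := by
  obtain ⟨r, -, hr⟩ := exists_graphPt_smul_mem hO 0
  rwa [smul_zero, graphPt_zero] at hr

theorem one_le_exp_of_origin_mem {n : ℕ} {e : Fin (n + 1) → ℝ} {s : ℝ}
    (h : origin n ∈ horoBallCl n e s) : 1 ≤ Real.exp s := by
  have h0 := h.2.2
  rw [← graphPt_zero, lprod_graphPt_dir] at h0
  simp only [zero_dotProduct, add_zero, Real.sqrt_one] at h0
  linarith

/-- A point lying in every closed horo-ball that contains `K` lies in `K`. -/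
theorem graphPt_mem_of_forall_horoBall {n : ℕ} {K : Set (Fin (n + 2) → ℝ)} (hK : IsHConvex n K)
    (hO : origin n ∈ relInt n K) (y : Fin (n + 1) → ℝ)
    (hy : ∀ e ∈ sph n, ∀ s : ℝ, K ⊆ horoBallCl n e s →
      Real.sqrt (1 + y ⬝ᵥ y) - y ⬝ᵥ e ≤ Real.exp s) : graphPt n y ∈ K := by
  by_contra hyK
  obtain ⟨t₁, ht₁, ht₁K⟩ := exists_graphPt_smul_mem hO y
  have hcont : Continuous fun t : ℝ => graphPt n (t • y) :=
    (continuous_graphPt n).comp (by fun_prop)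
  set S : Set ℝ := Icc 0 1 ∩ (fun t : ℝ => graphPt n (t • y)) ⁻¹' K with hS
  have hSc : IsCompact S := isCompact_Icc.inter_right (hK.2.1.preimage hcont)
  have ht₁S : t₁ ∈ S := ⟨Ioo_subset_Icc_self ht₁, ht₁K⟩
  obtain ⟨t, htS, htmax⟩ := hSc.exists_isGreatest ⟨t₁, ht₁S⟩
  have ht0 : 0 < t := ht₁.1.trans_le (htmax ht₁S)
  have ht1 : t < 1 := by
    refine lt_of_le_of_ne htS.1.2 ?_
    rintro rfl
    exact hyK (by simpa using htS.2)
  have hbd : graphPt n (t • y) ∈ closure (Hyp n \ K) := by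
    have hmem : t ∈ closure (Ioo t 1) := by
      rw [closure_Ioo ht1.ne]
      exact left_mem_Icc.2 ht1.le
    refine map_mem_closure (f := fun t : ℝ => graphPt n (t • y)) hcont hmem fun r hr =>
      ⟨graphPt_mem_Hyp n _, fun hrK => ?_⟩
    exact (htmax (a := r) ⟨⟨ht0.le.trans hr.1.le, hr.2.le⟩, hrK⟩).not_gt hr.1
  obtain ⟨e, he, s, hKs, -, hes⟩ := hK.2.2 _ ⟨htS.2, hbd⟩
  have hOK := origin_mem hO
  have h0 := one_le_exp_of_origin_mem (hKs hOK)
  have h1 := hy e he s hKs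
  rw [lprod_graphPt_dir] at hes
  simp only [smul_dotProduct, dotProduct_smul, smul_eq_mul] at hes
  have hq : 0 < y ⬝ᵥ y := by
    refine lt_of_le_of_ne (dotProduct_self_nonneg_real y) fun h => hyK ?_
    rw [dotProduct_self_eq_zero.1 h.symm, graphPt_zero]
    exact hOK
  have h2 := sqrt_one_add_smul_lt ht0 ht1 hq
  rw [sq, mul_assoc] at h2
  nlinarith

/-- Points of a paraboloidal region lie in every horo-ball containing the origin and the point
`(√(c² - 1) θ, c)`. -/
theorem sqrt_sub_dotProduct_le {ι : Type*} [Fintype ι] {y θ e : ι → ℝ} {c E : ℝ}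
    (he : e ⬝ᵥ e = 1) (hθ : θ ⬝ᵥ θ = 1) (hc : 2 ≤ c) (hp0 : 0 ≤ y ⬝ᵥ θ) (hpc : y ⬝ᵥ θ ≤ c / 4)
    (hy : 1 + y ⬝ᵥ y ≤ (y ⬝ᵥ θ + 1 / 4) ^ 2) (h1 : 1 ≤ E)
    (h2 : c - Real.sqrt (c ^ 2 - 1) * (θ ⬝ᵥ e) ≤ E) :
    Real.sqrt (1 + y ⬝ᵥ y) - y ⬝ᵥ e ≤ E := by
  set p := y ⬝ᵥ θ with hp
  set S := Real.sqrt (c ^ 2 - 1) with hS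
  have hS2 : S ^ 2 = c ^ 2 - 1 := Real.sq_sqrt (by nlinarith)
  have hS0 : 0 ≤ S := Real.sqrt_nonneg _
  have hSc : S ≤ c := by nlinarith
  have hcS : c / 2 ≤ S := by nlinarith
  have hSp : 0 < S := by linarith
  have ha : Real.sqrt (1 + y ⬝ᵥ y) ≤ p + 1 / 4 := Real.sqrt_le_iff.2 ⟨by linarith, hy⟩
  have hb : (2 * p) * (θ ⬝ᵥ e) - y ⬝ᵥ e ≤ p + 1 / 4 := by
    have hcs := dotProduct_sq_le ((2 * p) • θ - y) e
    have hsq : ((2 * p) • θ - y) ⬝ᵥ ((2 * p) • θ - y) = y ⬝ᵥ y := by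
      simp only [sub_dotProduct, dotProduct_sub, smul_dotProduct, dotProduct_smul, smul_eq_mul, hθ,
        dotProduct_comm θ y, ← hp]
      ring
    rw [hsq, he, mul_one] at hcs
    have hexp : ((2 * p) • θ - y) ⬝ᵥ e = (2 * p) * (θ ⬝ᵥ e) - y ⬝ᵥ e := by
      simp [sub_dotProduct]
    rw [hexp] at hcs
    exact abs_le_of_sq_le_sq' (by linarith) (by linarith) |>.2
  have hl1 : 2 * p / S ≤ 1 := by rw [div_le_one hSp]; linarith
  have hl0 : 0 ≤ 2 * p / S := by positivity
  have hE : (1 - 2 * p / S) * 1 + 2 * p / S * (c - S * (θ ⬝ᵥ e)) ≤ E := by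
    nlinarith
  have hlS : 2 * p / S * S = 2 * p := by field_simp
  have hge : 2 * p - 1 / 2 ≤ 2 * p / S * (c - 1) := by
    rw [div_mul_eq_mul_div, le_div_iff₀ hSp]
    nlinarith
  nlinarith

/-- The linear map with eigenvalue `σ ^ 2` on a unit vector `θ` and `σ` on its complement. -/
def stretch {m : ℕ} (σ : ℝ) (θ : Fin m → ℝ) : (Fin m → ℝ) →ₗ[ℝ] (Fin m → ℝ) :=
  Matrix.toLin' (σ • (1 + Matrix.replicateCol Unit ((σ - 1) • θ) * Matrix.replicateRow Unit θ))

theorem stretch_apply {m : ℕ} (σ : ℝ) (θ z : Fin m → ℝ) :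
    stretch σ θ z = σ • z + (σ * (σ - 1) * (z ⬝ᵥ θ)) • θ := by
  ext i
  simp only [stretch, Matrix.toLin'_apply, Matrix.smul_mulVec, Matrix.add_mulVec,
    Matrix.one_mulVec, ← Matrix.mulVec_mulVec, Pi.smul_apply, Pi.add_apply, smul_eq_mul]
  simp only [Matrix.mulVec, dotProduct, Matrix.replicateCol_apply, Matrix.replicateRow_apply,
    Finset.univ_unique, Finset.sum_singleton, Pi.smul_apply, smul_eq_mul]
  simp only [mul_comm (z _) (θ _)]
  ring

theorem det_stretch {m : ℕ} (σ : ℝ) {θ : Fin m → ℝ} (hθ : θ ⬝ᵥ θ = 1) :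
    LinearMap.det (stretch σ θ) = σ ^ (m + 1) := by
  rw [stretch, LinearMap.det_toLin', Matrix.det_smul,
    Matrix.det_one_add_replicateCol_mul_replicateRow, dotProduct_smul, hθ, Fintype.card_fin]
  simp only [smul_eq_mul]
  ring

/-- The closed Euclidean ball of radius `1/2`. -/
def halfBall (m : ℕ) : Set (Fin m → ℝ) := {z | z ⬝ᵥ z ≤ 1 / 4}

theorem isCompact_halfBall (m : ℕ) : IsCompact (halfBall m) := by
  refine Metric.isCompact_of_isClosed_isBounded ?_ ?_
  · exact isClosed_le (by unfold dotProduct; fun_prop) continuous_const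
  · refine (Metric.isBounded_closedBall (x := (0 : Fin m → ℝ)) (r := 1)).subset ?_
    intro z hz
    rw [mem_closedBall_zero_iff, pi_norm_le_iff_of_nonneg zero_le_one]
    intro i
    have h1 : z i ^ 2 ≤ ∑ j, z j ^ 2 :=
      Finset.single_le_sum (f := fun j => z j ^ 2) (fun j _ => sq_nonneg _) (Finset.mem_univ i)
    have h2 : z ⬝ᵥ z ≤ 1 / 4 := hz
    rw [sum_sq_eq_dotProduct] at h1
    exact abs_le_of_sq_le_sq (by linarith) zero_le_one

theorem volume_real_halfBall_pos (m : ℕ) : 0 < volume.real (halfBall m) := by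
  refine ENNReal.toReal_pos (ne_of_gt ?_) (isCompact_halfBall m).measure_lt_top.ne
  have ho : IsOpen {z : Fin m → ℝ | z ⬝ᵥ z < 1 / 4} :=
    isOpen_lt (by unfold dotProduct; fun_prop) continuous_const
  refine (ho.measure_pos volume ⟨0, by simp⟩).trans_le (measure_mono fun z hz => ?_)
  exact le_of_lt (mem_ofPred.1 hz)

/-- The ellipsoid obtained by stretching `halfBall` and moving its centre to `2 σ² θ`. -/
def ellipsoid {m : ℕ} (σ : ℝ) (θ : Fin m → ℝ) : Set (Fin m → ℝ) :=
  (fun y => (2 * σ ^ 2) • θ + y) '' (stretch σ θ '' halfBall m)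

theorem isCompact_ellipsoid {m : ℕ} (σ : ℝ) (θ : Fin m → ℝ) : IsCompact (ellipsoid σ θ) :=
  ((isCompact_halfBall m).image (stretch σ θ).continuous_of_finiteDimensional).image (by fun_prop)

theorem volume_real_ellipsoid {m : ℕ} {σ : ℝ} (hσ : 0 ≤ σ) {θ : Fin m → ℝ} (hθ : θ ⬝ᵥ θ = 1) :
    volume.real (ellipsoid σ θ) = σ ^ (m + 1) * volume.real (halfBall m) := by
  rw [Measure.real, ellipsoid, image_add_left, measure_preimage_add,
    Measure.addHaar_image_linearMap, det_stretch σ hθ, abs_of_nonneg (by positivity),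
    ENNReal.toReal_mul, ENNReal.toReal_ofReal (by positivity), Measure.real]

theorem ellipsoid_bounds {m : ℕ} {σ : ℝ} (hσ : 2 ≤ σ) {θ y : Fin m → ℝ} (hθ : θ ⬝ᵥ θ = 1)
    (hy : y ∈ ellipsoid σ θ) :
    0 ≤ y ⬝ᵥ θ ∧ y ⬝ᵥ θ ≤ 5 / 2 * σ ^ 2 ∧ 1 + y ⬝ᵥ y ≤ (y ⬝ᵥ θ + 1 / 4) ^ 2 := by
  obtain ⟨-, ⟨z, hz, rfl⟩, rfl⟩ := hy
  have hz' : z ⬝ᵥ z ≤ 1 / 4 := hz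
  have hcs := dotProduct_sq_le z θ
  rw [hθ, mul_one] at hcs
  have hzθ : |z ⬝ᵥ θ| ≤ 1 / 2 := abs_le_of_sq_le_sq (by linarith) (by norm_num)
  obtain ⟨ha, hb⟩ := abs_le.1 hzθ
  have hp : ((2 * σ ^ 2) • θ + stretch σ θ z) ⬝ᵥ θ = σ ^ 2 * (2 + z ⬝ᵥ θ) := by
    simp only [stretch_apply, add_dotProduct, smul_dotProduct, smul_eq_mul, hθ]
    ring
  have hq : ((2 * σ ^ 2) • θ + stretch σ θ z) ⬝ᵥ ((2 * σ ^ 2) • θ + stretch σ θ z) =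
      (σ ^ 2 * (2 + z ⬝ᵥ θ)) ^ 2 + σ ^ 2 * (z ⬝ᵥ z - (z ⬝ᵥ θ) ^ 2) := by
    simp only [stretch_apply, add_dotProduct, dotProduct_add, smul_dotProduct, dotProduct_smul,
      smul_eq_mul, hθ, dotProduct_comm θ z]
    ring
  rw [hp, hq]
  have hσ2 : 4 ≤ σ ^ 2 := by nlinarith
  refine ⟨by nlinarith, by nlinarith, ?_⟩
  nlinarith [sq_nonneg (z ⬝ᵥ θ), mul_nonneg (sq_nonneg σ) (sq_nonneg (z ⬝ᵥ θ))]

theorem ellipsoid_subset {n : ℕ} {K : Set (Fin (n + 2) → ℝ)} (hK : IsHConvex n K)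
    (hO : origin n ∈ relInt n K) {X : Fin (n + 2) → ℝ} (hX : X ∈ K) {σ : ℝ} (hσ : 2 ≤ σ)
    (hc : 10 * σ ^ 2 ≤ X (Fin.last (n + 1))) :
    ∃ θ : Fin (n + 1) → ℝ, θ ⬝ᵥ θ = 1 ∧ ∀ y ∈ ellipsoid σ θ, graphPt n y ∈ K := by
  set c := X (Fin.last (n + 1)) with hcdef
  have hc2 : 2 ≤ c := by nlinarith
  set S := Real.sqrt (c ^ 2 - 1) with hS
  have hS2 : S ^ 2 = c ^ 2 - 1 := Real.sq_sqrt (by nlinarith)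
  have hSp : 0 < S := Real.sqrt_pos.2 (by nlinarith)
  have hXX := init_dotProduct_self (hK.1 hX)
  rw [← hcdef, ← hS2] at hXX
  have hθ : (S⁻¹ • Fin.init X : Fin (n + 1) → ℝ) ⬝ᵥ (S⁻¹ • Fin.init X) = 1 := by
    simp only [smul_dotProduct, dotProduct_smul, smul_eq_mul, hXX]
    field_simp
  refine ⟨S⁻¹ • Fin.init X, hθ, fun y hy => ?_⟩
  obtain ⟨h1, h2, h3⟩ := ellipsoid_bounds hσ hθ hy
  refine graphPt_mem_of_forall_horoBall hK hO y fun e he s hs => ?_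
  have hee : e ⬝ᵥ e = 1 := by rw [← sum_sq_eq_dotProduct]; exact he
  refine sqrt_sub_dotProduct_le hee hθ hc2 h1 (by linarith) h3 ?_ ?_
  · exact one_le_exp_of_origin_mem (hs (origin_mem hO))
  · have := (hs hX).2.2
    rw [lprod_dir] at this
    rw [← hS, smul_dotProduct, smul_eq_mul, mul_inv_cancel_left₀ hSp.ne']
    linarith

theorem le_hypVol {n : ℕ} {K : Set (Fin (n + 2) → ℝ)} (hK : IsCompact K) {σ : ℝ} (hσ : 2 ≤ σ)
    {θ : Fin (n + 1) → ℝ} (hθ : θ ⬝ᵥ θ = 1) (hE : ∀ y ∈ ellipsoid σ θ, graphPt n y ∈ K) :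
    σ ^ n * volume.real (halfBall (n + 1)) / 3 ≤ hypVol n K := by
  set f : (Fin (n + 1) → ℝ) → ℝ := fun y => 1 / Real.sqrt (1 + ∑ i, y i ^ 2) with hf
  have hfc : Continuous f := by
    refine continuous_const.div (by fun_prop) fun y => ?_
    exact (Real.sqrt_pos.2 (by positivity)).ne'
  have hSc : IsCompact (graphPt n ⁻¹' K) := by
    have hcl : IsClosed (graphPt n ⁻¹' K) := hK.isClosed.preimage (continuous_graphPt n)
    have hi : IsCompact ((fun X : Fin (n + 2) → ℝ => (Fin.init X : Fin (n + 1) → ℝ)) '' K) :=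
      hK.image (continuous_pi fun i => by simpa [Fin.init] using continuous_apply _)
    refine hi.of_isClosed_subset hcl fun y hy => ⟨graphPt n y, hy, ?_⟩
    simp [graphPt]
  have hvol : hypVol n K = ∫ y in graphPt n ⁻¹' K, f y := by
    rw [← integral_indicator hSc.measurableSet]
    rfl
  have hfi : IntegrableOn f (graphPt n ⁻¹' K) := hfc.continuousOn.integrableOn_compact hSc
  have hEc := isCompact_ellipsoid σ θ
  have hsub : ellipsoid σ θ ⊆ graphPt n ⁻¹' K := hE
  have h1 : ∫ y in ellipsoid σ θ, f y ≤ ∫ y in graphPt n ⁻¹' K, f y :=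
    setIntegral_mono_set hfi (ae_of_all _ fun y => by simp only [hf]; positivity)
      hsub.eventuallyLE
  have h2 : 1 / (3 * σ ^ 2) * volume.real (ellipsoid σ θ) ≤ ∫ y in ellipsoid σ θ, f y := by
    refine setIntegral_ge_of_const_le_real hEc.measurableSet hEc.measure_lt_top.ne ?_
      (hfi.mono_set hsub)
    intro y hy
    obtain ⟨h3, h4, h5⟩ := ellipsoid_bounds hσ hθ hy
    refine one_div_le_one_div_of_le (Real.sqrt_pos.2 (by positivity)) ?_
    rw [sum_sq_eq_dotProduct]
    refine (Real.sqrt_le_iff.2 ⟨by linarith, h5⟩).trans ?_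
    nlinarith
  rw [volume_real_ellipsoid (by linarith) hθ] at h2
  rw [hvol]
  refine le_trans (le_of_eq ?_) (h2.trans h1)
  have : σ ≠ 0 := by linarith
  field_simp
  ring

/-- **Boundedness lemma.** For every `M > 0` there is a constant `C > 0` (depending only
on `M` and `n`) such that every h-convex body `K` containing `O` in its interior with
`V(K) ≤ M` has horospherical support function bounded above by `C`. -/
theorem suppFn_bounded_of_vol_bounded (n : ℕ) (hn : 1 ≤ n) (M : ℝ) (hM : 0 < M) :
    ∃ C : ℝ, 0 < C ∧ ∀ K : Set (Fin (n + 2) → ℝ), IsHConvexBody n K →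
      origin n ∈ relInt n K → hypVol n K ≤ M →
      ∀ e ∈ sph n, suppFn n K e ≤ C := by
  set v := volume.real (halfBall (n + 1)) with hv
  have hv0 : 0 < v := volume_real_halfBall_pos (n + 1)
  set σ := 3 * M / v + 2 with hσdef
  have hσ : 2 ≤ σ := by
    have : 0 ≤ 3 * M / v := by positivity
    linarith
  refine ⟨Real.log (20 * σ ^ 2), Real.log_pos (by nlinarith), ?_⟩
  intro K hK hO hVK e he
  have hbound : ∀ X ∈ K, X (Fin.last (n + 1)) < 10 * σ ^ 2 := by
    intro X hX
    by_contra! hc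
    obtain ⟨θ, hθ, hE⟩ := ellipsoid_subset hK.1 hO hX hσ hc
    have h1 := le_hypVol hK.2.1 hσ hθ hE
    have h2 : σ ≤ σ ^ n := le_self_pow₀ (by linarith) (by omega)
    have h3 : σ * v = 3 * M + 2 * v := by
      rw [hσdef]
      field_simp
    nlinarith
  refine Real.sSup_le ?_ (Real.log_pos (by nlinarith)).le
  rintro _ ⟨X, hX, rfl⟩
  have hXH := hK.1.1 hX
  have hXX := init_dotProduct_self hXH
  have hX0 : 0 < X (Fin.last (n + 1)) := hXH.2
  have hee : e ⬝ᵥ e = 1 := by rw [← sum_sq_eq_dotProduct]; exact he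
  have hcs := dotProduct_sq_le (Fin.init X : Fin (n + 1) → ℝ) e
  rw [hXX, hee, mul_one] at hcs
  obtain ⟨ha, hb⟩ := abs_lt.1 (abs_lt_of_sq_lt_sq (a := Fin.init X ⬝ᵥ e)
    (b := X (Fin.last (n + 1))) (by linarith) hX0.le)
  have hXb := hbound X hX
  simp only [lprod_dir]
  exact Real.log_le_log (by linarith) (by linarith)

end Horo
end
end
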